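/- arXiv:2111.12533 — 4 statements merged into one kernel-verified Lean document; each statement's English description precedes it below -/
import Mathlib

section
/- For every convex body K ⊆ ℝ² of unit area, n^{-2} · EH^K_{2,4}(n) converges to 10 − 2π²/3 as n → ∞. -/
open MeasureTheory Filter

noncomputable section

abbrev Euc (d : ℕ) : Type := EuclideanSpace ℝ (Fin d)

/-- A convex body: compact convex set with nonempty interior. -/
def IsConvexBody {d : ℕ} (K : Set (Euc d)) : Prop :=
  Convex ℝ K ∧ IsCompact K ∧ (interior K).Nonempty

/-- A set of points is in convex position if no point lies in the convex
hull of the others. -/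
def InConvexPosition {d : ℕ} (P : Set (Euc d)) : Prop :=
  ∀ p ∈ P, p ∉ convexHull ℝ (P \ {p})

/-- `H` is a `k`-hole in `S`. -/
def IsHole {d : ℕ} (k : ℕ) (S H : Finset (Euc d)) : Prop :=
  H ⊆ S ∧ H.card = k ∧ InConvexPosition (H : Set (Euc d)) ∧
    ∀ p ∈ S, p ∉ interior (convexHull ℝ (H : Set (Euc d)))

open Classical in
/-- The number of `k`-holes in the point set given by `x`. -/
noncomputable def holeCount (d k n : ℕ) (x : Fin n → Euc d) : ℕ :=
  ((Finset.image x Finset.univ).powerset.filter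
    (fun H => IsHole k (Finset.image x Finset.univ) H)).card

/-- The uniform probability distribution on `K`. -/
noncomputable def unif {d : ℕ} (K : Set (Euc d)) : Measure (Euc d) :=
  (volume K)⁻¹ • volume.restrict K

/-- The expected number of `k`-holes among `n` points drawn uniformly and
independently at random from `K`. -/
noncomputable def EH (d k : ℕ) (K : Set (Euc d)) (n : ℕ) : ℝ :=
  ∫ x : Fin n → Euc d, (holeCount d k n x : ℝ) ∂(Measure.pi fun _ : Fin n => unif K)

/-- The probability that, for `d+2` points chosen uniformly and independently
at random from `K`, one of the points lies in the convex hull of the others. -/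
noncomputable def pSimplex (d : ℕ) (K : Set (Euc d)) : ℝ :=
  ((Measure.pi fun _ : Fin (d + 2) => unif K)
    {x : Fin (d + 2) → Euc d | ∃ i, x i ∈ convexHull ℝ (x '' {j | j ≠ i})}).toReal

/-- The maximum of `pSimplex d K` over all convex bodies `K ⊆ ℝ^d`. -/
noncomputable def pMax (d : ℕ) : ℝ :=
  sSup {p : ℝ | ∃ K : Set (Euc d), IsConvexBody K ∧ p = pSimplex d K}

end

/-- An affine change of variables in the plane. -/
theorem lintegral_comp_affine_plane {a b c d : ℝ} (h : a * d - b * c ≠ 0) (e g : ℝ)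
    {f : ℝ × ℝ → ENNReal} (hf : Measurable f) :
    ∫⁻ z : ℝ × ℝ, f (a * z.1 + b * z.2 + e, c * z.1 + d * z.2 + g) =
      ENNReal.ofReal |(a * d - b * c)⁻¹| * ∫⁻ z, f z := by
  set T := Matrix.toLin (Module.Basis.finTwoProd ℝ) (Module.Basis.finTwoProd ℝ) !![a, b; c, d]
    with hT
  have hdet : LinearMap.det T = a * d - b * c := by
    rw [hT, LinearMap.det_toLin, Matrix.det_fin_two_of]
  have hmap := Measure.map_linearMap_addHaar_eq_smul_addHaar (volume : Measure (ℝ × ℝ))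
    (f := T) (by rwa [hdet])
  have hTm : Measurable T := T.continuous_of_finiteDimensional.measurable
  have h1 : ∀ z : ℝ × ℝ, f (a * z.1 + b * z.2 + e, c * z.1 + d * z.2 + g) =
      (fun z => f (z + (e, g))) (T z) := by
    intro z
    simp [hT, Matrix.toLin_finTwoProd_apply]
  simp_rw [h1]
  rw [← lintegral_map (f := fun z => f (z + (e, g))) (by fun_prop) hTm, hmap,
    lintegral_smul_measure, lintegral_add_right_eq_self f (e, g), hdet, smul_eq_mul]

theorem measurableSet_affine_plane_preimage (a b c d e g : ℝ) {s : Set (ℝ × ℝ)}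
    (hs : MeasurableSet s) :
    MeasurableSet {z : ℝ × ℝ | (a * z.1 + b * z.2 + e, c * z.1 + d * z.2 + g) ∈ s} :=
  hs.preimage (f := fun z : ℝ × ℝ => (a * z.1 + b * z.2 + e, c * z.1 + d * z.2 + g)) (by fun_prop)

theorem volume_affine_plane_preimage {a b c d : ℝ} (h : a * d - b * c ≠ 0) (e g : ℝ)
    {s : Set (ℝ × ℝ)} (hs : MeasurableSet s) :
    volume s = ENNReal.ofReal |a * d - b * c| *
      volume {z : ℝ × ℝ | (a * z.1 + b * z.2 + e, c * z.1 + d * z.2 + g) ∈ s} := by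
  have h1 := lintegral_comp_affine_plane h e g (f := s.indicator 1)
    (measurable_one.indicator hs)
  have h2 : ∀ z : ℝ × ℝ, s.indicator (1 : ℝ × ℝ → ENNReal)
      (a * z.1 + b * z.2 + e, c * z.1 + d * z.2 + g) =
      {z : ℝ × ℝ | (a * z.1 + b * z.2 + e, c * z.1 + d * z.2 + g) ∈ s}.indicator 1 z := by
    intro z; rfl
  rw [lintegral_congr h2, lintegral_indicator_one hs,
    lintegral_indicator_one (measurableSet_affine_plane_preimage a b c d e g hs)] at h1
  rw [h1, ← mul_assoc, ← ENNReal.ofReal_mul (abs_nonneg _), ← abs_mul, mul_inv_cancel₀ h]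
  simp

theorem lintegral_Ioi_exp_neg {α : ℝ} (hα : 0 < α) :
    ∫⁻ x : ℝ, (if 0 < x then ENNReal.ofReal (Real.exp (-(α * x))) else 0) =
      ENNReal.ofReal α⁻¹ := by
  have h : ∀ x : ℝ, (if 0 < x then ENNReal.ofReal (Real.exp (-(α * x))) else 0) =
      (Set.Ioi (0 : ℝ)).indicator (fun x => ENNReal.ofReal (Real.exp (-α * x))) x := by
    intro x; simp [Set.indicator_apply]
  simp_rw [h]
  rw [lintegral_indicator measurableSet_Ioi, ← ofReal_integral_eq_lintegral_ofReal]
  · rw [integral_exp_mul_Ioi (by linarith) 0]; simp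
  · exact integrableOn_exp_mul_Ioi (by linarith) 0
  · exact ae_of_all _ fun x => (Real.exp_pos _).le

/-- The integral of an exponential function over a planar cone spanned by `(a, c)`, `(b, d)`. -/
theorem lintegral_cone_exp {a b c d : ℝ} (h : a * d - b * c ≠ 0) {α β : ℝ} (hα : 0 < α)
    (hβ : 0 < β) {f : ℝ × ℝ → ENNReal} (hf : Measurable f)
    (hfe : ∀ x y : ℝ, f (a * x + b * y, c * x + d * y) =
      if 0 < x ∧ 0 < y then ENNReal.ofReal (Real.exp (-(α * x + β * y))) else 0) :
    ∫⁻ z, f z = ENNReal.ofReal (|a * d - b * c| / (α * β)) := by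
  have h1 := lintegral_comp_affine_plane h 0 0 hf
  simp only [add_zero, hfe] at h1
  have h2 : ∀ z : ℝ × ℝ, (if 0 < z.1 ∧ 0 < z.2 then
        ENNReal.ofReal (Real.exp (-(α * z.1 + β * z.2))) else 0) =
      (if 0 < z.1 then ENNReal.ofReal (Real.exp (-(α * z.1))) else 0) *
      (if 0 < z.2 then ENNReal.ofReal (Real.exp (-(β * z.2))) else 0) := by
    intro z
    by_cases h1 : 0 < z.1 <;> by_cases h2 : 0 < z.2 <;> simp [h1, h2]
    rw [← ENNReal.ofReal_mul (Real.exp_pos _).le, ← Real.exp_add]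
    congr 2; ring
  have hm : ∀ γ : ℝ, Measurable
      (fun x : ℝ => if 0 < x then ENNReal.ofReal (Real.exp (-(γ * x))) else 0) := fun γ =>
    Measurable.ite measurableSet_Ioi (by fun_prop) (by fun_prop)
  simp_rw [h2] at h1
  rw [Measure.volume_eq_prod, lintegral_prod_mul (hm α).aemeasurable (hm β).aemeasurable,
    lintegral_Ioi_exp_neg hα, lintegral_Ioi_exp_neg hβ] at h1
  have h3 : ∫⁻ z, f z = ENNReal.ofReal |a * d - b * c| *
      (ENNReal.ofReal |(a * d - b * c)⁻¹| * ∫⁻ z, f z) := by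
    rw [← mul_assoc, ← ENNReal.ofReal_mul (abs_nonneg _), ← abs_mul, mul_inv_cancel₀ h]
    simp
  rw [h3, Measure.volume_eq_prod, ← h1, ← ENNReal.ofReal_mul (by positivity),
    ← ENNReal.ofReal_mul (by positivity)]
  congr 1
  field_simp

theorem measurable_ite_lt_and {α : Type*} [MeasurableSpace α] {f₁ g₁ f₂ g₂ : α → ℝ}
    {F : α → ENNReal} (hf₁ : Measurable f₁) (hg₁ : Measurable g₁) (hf₂ : Measurable f₂)
    (hg₂ : Measurable g₂) (hF : Measurable F) :
    Measurable fun x => if f₁ x < g₁ x ∧ f₂ x < g₂ x then F x else 0 :=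
  Measurable.ite ((measurableSet_lt hf₁ hg₁).inter (measurableSet_lt hf₂ hg₂) :
    MeasurableSet ({x | f₁ x < g₁ x} ∩ {x | f₂ x < g₂ x})) hF measurable_const

/-- The weight of the quadrilateral with vertices `(0, 0)`, `(t₁, w₁)`, `(t₂, w₂)`, `(1, 0)`:
the value of `φ` at its area if `0 < t₁ < t₂ < 1` and the vertices are in convex position,
and `0` otherwise. -/
noncomputable def quadWeight (φ : ℝ → ENNReal) (t₁ t₂ w₁ w₂ : ℝ) : ENNReal :=
  if 0 < t₁ ∧ t₁ < t₂ ∧ t₂ < 1 then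
    (if 0 < w₁ ∧ w₂ < 0 then φ ((w₁ - w₂) / 2) else 0) +
    (if w₁ < 0 ∧ 0 < w₂ then φ ((w₂ - w₁) / 2) else 0) +
    (if t₁ * w₂ < t₂ * w₁ ∧ (1 - t₂) * w₁ < (1 - t₁) * w₂ then
      φ ((t₂ * w₁ + (1 - t₁) * w₂) / 2) else 0) +
    (if t₂ * w₁ < t₁ * w₂ ∧ (1 - t₁) * w₂ < (1 - t₂) * w₁ then
      φ (-(t₂ * w₁ + (1 - t₁) * w₂) / 2) else 0)
  else 0

theorem measurable_quadWeight {φ : ℝ → ENNReal} (hφ : Measurable φ) :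
    Measurable fun z : (ℝ × ℝ) × (ℝ × ℝ) => quadWeight φ z.1.1 z.1.2 z.2.1 z.2.2 := by
  unfold quadWeight
  refine Measurable.ite ?_ (((Measurable.add ?_ ?_).add ?_).add ?_) measurable_const
  · have h1 : MeasurableSet {z : (ℝ × ℝ) × (ℝ × ℝ) | 0 < z.1.1} :=
      measurableSet_lt (by fun_prop) (by fun_prop)
    have h2 : MeasurableSet {z : (ℝ × ℝ) × (ℝ × ℝ) | z.1.1 < z.1.2} :=
      measurableSet_lt (by fun_prop) (by fun_prop)
    have h3 : MeasurableSet {z : (ℝ × ℝ) × (ℝ × ℝ) | z.1.2 < 1} :=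
      measurableSet_lt (by fun_prop) (by fun_prop)
    exact h1.inter (h2.inter h3)
  all_goals
    refine measurable_ite_lt_and ?_ ?_ ?_ ?_ ?_ <;> fun_prop

theorem lintegral_quadWeight_exp {l t₁ t₂ : ℝ} (hl : 0 < l) (h0 : 0 < t₁) (h1 : t₁ < t₂)
    (h2 : t₂ < 1) :
    ∫⁻ w : ℝ × ℝ, quadWeight (fun a => ENNReal.ofReal (Real.exp (-(l * a)))) t₁ t₂ w.1 w.2 =
      ENNReal.ofReal (8 / l ^ 2) * (1 + ENNReal.ofReal ((t₂ - t₁) / (t₂ * (1 - t₁)))) := by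
  have ht : 0 < t₂ := h0.trans h1
  have ht' : 0 < 1 - t₁ := by linarith
  have hd : 0 < t₂ - t₁ := by linarith
  simp only [quadWeight, h0, h1, h2, and_self, if_true]
  have e1 : ∫⁻ w : ℝ × ℝ, (if 0 < w.1 ∧ w.2 < 0 then
      ENNReal.ofReal (Real.exp (-(l * ((w.1 - w.2) / 2)))) else 0) =
        ENNReal.ofReal (4 / l ^ 2) := by
    rw [lintegral_cone_exp (a := 1) (b := 0) (c := 0) (d := -1) (α := l / 2) (β := l / 2)
      (by norm_num) (by positivity) (by positivity)]
    · congr 1; norm_num; field_simp; norm_num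
    · refine measurable_ite_lt_and ?_ ?_ ?_ ?_ ?_ <;> fun_prop
    · intro x y
      simp only [one_mul, zero_mul, add_zero, zero_add, neg_mul, Left.neg_neg_iff]
      congr 3
      ring
  have e2 : ∫⁻ w : ℝ × ℝ, (if w.1 < 0 ∧ 0 < w.2 then
      ENNReal.ofReal (Real.exp (-(l * ((w.2 - w.1) / 2)))) else 0) =
        ENNReal.ofReal (4 / l ^ 2) := by
    rw [lintegral_cone_exp (a := -1) (b := 0) (c := 0) (d := 1) (α := l / 2) (β := l / 2)
      (by norm_num) (by positivity) (by positivity)]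
    · congr 1; norm_num; field_simp; norm_num
    · refine measurable_ite_lt_and ?_ ?_ ?_ ?_ ?_ <;> fun_prop
    · intro x y
      simp only [one_mul, zero_mul, add_zero, zero_add, neg_mul, Left.neg_neg_iff]
      congr 3
      ring
  have e3 : ∫⁻ w : ℝ × ℝ, (if t₁ * w.2 < t₂ * w.1 ∧ (1 - t₂) * w.1 < (1 - t₁) * w.2 then
      ENNReal.ofReal (Real.exp (-(l * ((t₂ * w.1 + (1 - t₁) * w.2) / 2)))) else 0) =
        ENNReal.ofReal (4 / l ^ 2 * ((t₂ - t₁) / (t₂ * (1 - t₁)))) := by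
    have hdet : t₁ * (1 - t₂) - (1 - t₁) * t₂ = -(t₂ - t₁) := by ring
    rw [lintegral_cone_exp (a := t₁) (b := 1 - t₁) (c := t₂) (d := 1 - t₂) (α := l * t₂ / 2)
      (β := l * (1 - t₁) / 2) (by rw [hdet]; linarith) (by positivity) (by positivity)]
    · rw [hdet, abs_neg, abs_of_pos hd]
      congr 1; field_simp; norm_num
    · refine measurable_ite_lt_and ?_ ?_ ?_ ?_ ?_ <;> fun_prop
    · intro x y
      have i1 : t₁ * (t₂ * x + (1 - t₂) * y) < t₂ * (t₁ * x + (1 - t₁) * y) ↔ 0 < y := by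
        rw [← sub_pos, show t₂ * (t₁ * x + (1 - t₁) * y) - t₁ * (t₂ * x + (1 - t₂) * y) =
          (t₂ - t₁) * y by ring, mul_pos_iff_of_pos_left hd]
      have i2 : (1 - t₂) * (t₁ * x + (1 - t₁) * y) < (1 - t₁) * (t₂ * x + (1 - t₂) * y) ↔
          0 < x := by
        rw [← sub_pos, show (1 - t₁) * (t₂ * x + (1 - t₂) * y) -
          (1 - t₂) * (t₁ * x + (1 - t₁) * y) = (t₂ - t₁) * x by ring, mul_pos_iff_of_pos_left hd]
      simp only [i1, i2, and_comm (a := 0 < y)]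
      congr 3
      ring
  have e4 : ∫⁻ w : ℝ × ℝ, (if t₂ * w.1 < t₁ * w.2 ∧ (1 - t₁) * w.2 < (1 - t₂) * w.1 then
      ENNReal.ofReal (Real.exp (-(l * (-(t₂ * w.1 + (1 - t₁) * w.2) / 2)))) else 0) =
        ENNReal.ofReal (4 / l ^ 2 * ((t₂ - t₁) / (t₂ * (1 - t₁)))) := by
    have hdet : -t₁ * -(1 - t₂) - -(1 - t₁) * -t₂ = -(t₂ - t₁) := by ring
    rw [lintegral_cone_exp (a := -t₁) (b := -(1 - t₁)) (c := -t₂) (d := -(1 - t₂))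
      (α := l * t₂ / 2)
      (β := l * (1 - t₁) / 2) (by rw [hdet]; linarith) (by positivity) (by positivity)]
    · rw [hdet, abs_neg, abs_of_pos hd]
      congr 1; field_simp; norm_num
    · refine measurable_ite_lt_and ?_ ?_ ?_ ?_ ?_ <;> fun_prop
    · intro x y
      have i1 : t₂ * (-t₁ * x + -(1 - t₁) * y) < t₁ * (-t₂ * x + -(1 - t₂) * y) ↔ 0 < y := by
        rw [← sub_pos, show t₁ * (-t₂ * x + -(1 - t₂) * y) - t₂ * (-t₁ * x + -(1 - t₁) * y) =
          (t₂ - t₁) * y by ring, mul_pos_iff_of_pos_left hd]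
      have i2 : (1 - t₁) * (-t₂ * x + -(1 - t₂) * y) < (1 - t₂) * (-t₁ * x + -(1 - t₁) * y) ↔
          0 < x := by
        rw [← sub_pos, show (1 - t₂) * (-t₁ * x + -(1 - t₁) * y) -
          (1 - t₁) * (-t₂ * x + -(1 - t₂) * y) = (t₂ - t₁) * x by ring, mul_pos_iff_of_pos_left hd]
      simp only [i1, i2, and_comm (a := 0 < y)]
      congr 3
      ring
  rw [lintegral_add_left, lintegral_add_left, lintegral_add_left, e1, e2, e3, e4]
  · have hx : 0 < (t₂ - t₁) / (t₂ * (1 - t₁)) := by positivity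
    rw [← ENNReal.ofReal_one, ← ENNReal.ofReal_add zero_le_one hx.le,
      ← ENNReal.ofReal_mul (by positivity), ← ENNReal.ofReal_add (by positivity) (by positivity),
      ← ENNReal.ofReal_add (by positivity) (by positivity),
      ← ENNReal.ofReal_add (by positivity) (by positivity)]
    congr 1
    ring
  · refine measurable_ite_lt_and ?_ ?_ ?_ ?_ ?_ <;> fun_prop
  · refine Measurable.add ?_ ?_ <;>
    refine measurable_ite_lt_and ?_ ?_ ?_ ?_ ?_ <;> fun_prop
  · refine Measurable.add (Measurable.add ?_ ?_) ?_ <;>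
    refine measurable_ite_lt_and ?_ ?_ ?_ ?_ ?_ <;> fun_prop

theorem hasSum_inv_succ_mul_sq :
    HasSum (fun k : ℕ => 1 / (((k : ℝ) + 1) * ((k : ℝ) + 2) ^ 2)) (2 - Real.pi ^ 2 / 6) := by
  have h1 : HasSum (fun k : ℕ => 1 / ((k : ℝ) + 2) ^ 2) (Real.pi ^ 2 / 6 - 1) := by
    have := (hasSum_nat_add_iff' 2).2 hasSum_zeta_two
    simpa [Finset.sum_range_succ] using this
  have h2 : HasSum (fun k : ℕ => 1 / ((k : ℝ) + 1) - 1 / ((k : ℝ) + 2)) 1 := by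
    rw [hasSum_iff_tendsto_nat_of_nonneg]
    · have h : ∀ n : ℕ, ∑ k ∈ Finset.range n, (1 / ((k : ℝ) + 1) - 1 / ((k : ℝ) + 2)) =
          1 - 1 / ((n : ℝ) + 1) := by
        intro n
        induction n with
        | zero => simp
        | succ n ih =>
          rw [Finset.sum_range_succ, ih]; push_cast
          ring_nf
      simp_rw [h]
      simpa using tendsto_one_div_add_atTop_nhds_zero_nat.const_sub (1 : ℝ)
    · intro k
      rw [sub_nonneg]
      exact one_div_le_one_div_of_le (by positivity) (by linarith)
  have h3 : (fun k : ℕ => 1 / (((k : ℝ) + 1) * ((k : ℝ) + 2) ^ 2)) =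
      fun k : ℕ => 1 / ((k : ℝ) + 1) - 1 / ((k : ℝ) + 2) - 1 / ((k : ℝ) + 2) ^ 2 := by
    ext k
    field_simp
    ring
  rw [h3, show 2 - Real.pi ^ 2 / 6 = 1 - (Real.pi ^ 2 / 6 - 1) by ring]
  exact h2.sub h1

theorem lintegral_Ioo_ofReal {a b : ℝ} (hab : a ≤ b) {f : ℝ → ℝ} (hf : Continuous f)
    (hf0 : ∀ x ∈ Set.Ioo a b, 0 ≤ f x) :
    ∫⁻ x in Set.Ioo a b, ENNReal.ofReal (f x) = ENNReal.ofReal (∫ x in a..b, f x) := by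
  rw [← ofReal_integral_eq_lintegral_ofReal, intervalIntegral.integral_of_le hab,
    integral_Ioc_eq_integral_Ioo]
  · exact hf.integrableOn_Icc.mono_set Set.Ioo_subset_Icc_self
  · exact (ae_restrict_mem measurableSet_Ioo).mono hf0

theorem lintegral_triangle_term (k : ℕ) {t : ℝ} (ht : 0 < t) :
    ∫⁻ s in Set.Ioo 0 t, ENNReal.ofReal ((t - s) * s ^ k / t) =
      ENNReal.ofReal (t ^ (k + 1) / (((k : ℝ) + 1) * (k + 2))) := by
  rw [lintegral_Ioo_ofReal ht.le (by fun_prop)]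
  · congr 1
    have : ∀ s : ℝ, (t - s) * s ^ k / t = s ^ k - t⁻¹ * s ^ (k + 1) := by
      intro s; field_simp; ring
    simp_rw [this]
    rw [intervalIntegral.integral_sub (by apply Continuous.intervalIntegrable; fun_prop)
      (by apply Continuous.intervalIntegrable; fun_prop), intervalIntegral.integral_const_mul,
      integral_pow, integral_pow]
    push_cast
    field_simp
    ring
  · intro s hs
    have := hs.1
    have : 0 < t - s := sub_pos.2 hs.2
    positivity

theorem lintegral_triangle :
    ∫⁻ t in Set.Ioo (0 : ℝ) 1, ∫⁻ s in Set.Ioo 0 t,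
      (1 + ENNReal.ofReal ((t - s) / (t * (1 - s)))) =
        ENNReal.ofReal (5 / 2 - Real.pi ^ 2 / 6) := by
  have h1 : ∀ t ∈ Set.Ioo (0 : ℝ) 1, ∫⁻ s in Set.Ioo 0 t,
      (1 + ENNReal.ofReal ((t - s) / (t * (1 - s)))) =
      ENNReal.ofReal t + ∑' k : ℕ, ENNReal.ofReal (t ^ (k + 1) / (((k : ℝ) + 1) * (k + 2))) := by
    intro t ht
    rw [lintegral_add_left measurable_const]
    congr 1
    · simp
    · have h2 : ∀ s ∈ Set.Ioo 0 t, ENNReal.ofReal ((t - s) / (t * (1 - s))) =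
          ∑' k : ℕ, ENNReal.ofReal ((t - s) * s ^ k / t) := by
        intro s hs
        have hs0 := hs.1
        have hst : 0 < t - s := sub_pos.2 hs.2
        have ht0 := ht.1
        have hs1 : s < 1 := hs.2.trans ht.2
        have hsum : HasSum (fun k : ℕ => (t - s) * s ^ k / t) ((t - s) / (t * (1 - s))) := by
          have := (hasSum_geometric_of_lt_one hs0.le hs1).mul_left ((t - s) / t)
          have h1s : 1 - s ≠ 0 := by linarith
          rw [show (t - s) / (t * (1 - s)) = (t - s) / t * (1 - s)⁻¹ by field_simp]
          exact this.congr_fun fun k => by ring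
        rw [← hsum.tsum_eq, ENNReal.ofReal_tsum_of_nonneg (fun k => by positivity) hsum.summable]
      rw [setLIntegral_congr_fun measurableSet_Ioo h2, lintegral_tsum (fun k => by fun_prop)]
      simp_rw [lintegral_triangle_term _ ht.1]
  rw [setLIntegral_congr_fun measurableSet_Ioo h1, lintegral_add_left (by fun_prop),
    lintegral_tsum (fun k => by fun_prop)]
  have h3 : ∀ k : ℕ, ∫⁻ t in Set.Ioo (0 : ℝ) 1,
      ENNReal.ofReal (t ^ (k + 1) / (((k : ℝ) + 1) * (k + 2))) =
      ENNReal.ofReal (1 / (((k : ℝ) + 1) * ((k : ℝ) + 2) ^ 2)) := by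
    intro k
    rw [lintegral_Ioo_ofReal zero_le_one (by fun_prop)]
    · rw [intervalIntegral.integral_div, integral_pow]
      congr 1
      push_cast
      field_simp
      simp
      ring
    · intro x hx
      have := hx.1
      positivity
  simp_rw [h3]
  rw [← ENNReal.ofReal_tsum_of_nonneg (fun k => by positivity) hasSum_inv_succ_mul_sq.summable,
    hasSum_inv_succ_mul_sq.tsum_eq, lintegral_Ioo_ofReal (f := fun x => x) zero_le_one continuous_id
      (fun x hx => hx.1.le), ← ENNReal.ofReal_add]
  · congr 1
    simp
    ring
  · simp
  · exact hasSum_inv_succ_mul_sq.nonneg (fun k => by positivity)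

/-- The total weight of all quadrilaterals for an exponential `φ`. -/
theorem lintegral_quadWeight_exp_total {l : ℝ} (hl : 0 < l) :
    ∫⁻ z : (ℝ × ℝ) × (ℝ × ℝ),
      quadWeight (fun a => ENNReal.ofReal (Real.exp (-(l * a)))) z.1.1 z.2.1 z.1.2 z.2.2 =
      ENNReal.ofReal (8 / l ^ 2) * ENNReal.ofReal (5 / 2 - Real.pi ^ 2 / 6) := by
  set φ : ℝ → ENNReal := fun a => ENNReal.ofReal (Real.exp (-(l * a))) with hφ
  have hm := measurable_quadWeight (φ := φ) (by fun_prop)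
  have hm1 : Measurable fun z : (ℝ × ℝ) × (ℝ × ℝ) => quadWeight φ z.1.1 z.2.1 z.1.2 z.2.2 :=
    hm.comp (g := fun z : (ℝ × ℝ) × (ℝ × ℝ) => quadWeight φ z.1.1 z.1.2 z.2.1 z.2.2)
      (f := fun z : (ℝ × ℝ) × (ℝ × ℝ) => ((z.1.1, z.2.1), (z.1.2, z.2.2))) (by fun_prop)
  have key : ∀ t₁ t₂ : ℝ, ∫⁻ w : ℝ × ℝ, quadWeight φ t₁ t₂ w.1 w.2 =
      ENNReal.ofReal (8 / l ^ 2) * (Set.Ioo (0 : ℝ) 1).indicator (fun t =>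
        (Set.Ioo 0 t).indicator (fun s => 1 + ENNReal.ofReal ((t - s) / (t * (1 - s)))) t₁) t₂ := by
    intro t₁ t₂
    by_cases h : 0 < t₁ ∧ t₁ < t₂ ∧ t₂ < 1
    · rw [lintegral_quadWeight_exp hl h.1 h.2.1 h.2.2, Set.indicator_of_mem,
        Set.indicator_of_mem]
      · exact ⟨h.1, h.2.1⟩
      · exact ⟨h.1.trans h.2.1, h.2.2⟩
    · simp only [quadWeight, h, if_false, lintegral_zero]
      by_cases h2 : t₂ ∈ Set.Ioo (0 : ℝ) 1
      · rw [Set.indicator_of_mem h2, Set.indicator_of_notMem, mul_zero]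
        exact fun h1 => h ⟨h1.1, h1.2, h2.2⟩
      · rw [Set.indicator_of_notMem h2, mul_zero]
  calc ∫⁻ z : (ℝ × ℝ) × (ℝ × ℝ), quadWeight φ z.1.1 z.2.1 z.1.2 z.2.2
      = ∫⁻ t₁ : ℝ, ∫⁻ w₁ : ℝ, ∫⁻ t₂ : ℝ, ∫⁻ w₂ : ℝ, quadWeight φ t₁ t₂ w₁ w₂ := by
        rw [Measure.volume_eq_prod, lintegral_prod _ hm1.aemeasurable, Measure.volume_eq_prod,
          lintegral_prod _ (by exact hm1.lintegral_prod_right'.aemeasurable)]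
        refine lintegral_congr fun t₁ => lintegral_congr fun w₁ => ?_
        rw [lintegral_prod _ (by exact (hm1.comp measurable_prodMk_left).aemeasurable)]
    _ = ∫⁻ t₁ : ℝ, ∫⁻ t₂ : ℝ, ∫⁻ w₁ : ℝ, ∫⁻ w₂ : ℝ, quadWeight φ t₁ t₂ w₁ w₂ := by
        refine lintegral_congr fun t₁ => ?_
        rw [lintegral_lintegral_swap]
        refine Measurable.aemeasurable ?_
        exact (hm.comp (g := fun z : (ℝ × ℝ) × (ℝ × ℝ) => quadWeight φ z.1.1 z.1.2 z.2.1 z.2.2)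
          (f := fun z : (ℝ × ℝ) × ℝ => ((t₁, z.1.2), (z.1.1, z.2)))
            (by fun_prop)).lintegral_prod_right'
    _ = ∫⁻ t₁ : ℝ, ∫⁻ t₂ : ℝ, ∫⁻ w : ℝ × ℝ, quadWeight φ t₁ t₂ w.1 w.2 := by
        refine lintegral_congr fun t₁ => lintegral_congr fun t₂ => ?_
        rw [Measure.volume_eq_prod,
          lintegral_prod _ (by exact (hm.comp (measurable_prodMk_left (x := (t₁, t₂)))).aemeasurable)]
    _ = ∫⁻ t₂ : ℝ, ∫⁻ t₁ : ℝ, ∫⁻ w : ℝ × ℝ, quadWeight φ t₁ t₂ w.1 w.2 := by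
        rw [lintegral_lintegral_swap]
        exact hm.lintegral_prod_right'.aemeasurable
    _ = _ := by
        simp_rw [key]
        rw [← lintegral_triangle, ← lintegral_const_mul' _ _ ENNReal.ofReal_ne_top,
          ← lintegral_indicator measurableSet_Ioo]
        refine lintegral_congr fun t₂ => ?_
        rw [lintegral_const_mul' _ _ ENNReal.ofReal_ne_top]
        by_cases h2 : t₂ ∈ Set.Ioo (0 : ℝ) 1
        · simp only [Set.indicator_of_mem h2]
          rw [lintegral_indicator measurableSet_Ioo]
        · simp only [Set.indicator_of_notMem h2, lintegral_zero, mul_zero]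

theorem convex_halfPlane (a b c : ℝ) : Convex ℝ {z : ℝ × ℝ | a * z.1 + b * z.2 ≤ c} := by
  refine convex_halfSpace_le ⟨fun x y => ?_, fun r x => ?_⟩ c
  · simp only [Prod.fst_add, Prod.snd_add]; ring
  · simp only [Prod.smul_fst, Prod.smul_snd, smul_eq_mul]; ring

theorem mem_convexHull_triple {E : Type*} [AddCommGroup E] [Module ℝ E] {P Q R z : E} {a b c : ℝ}
    (ha : 0 ≤ a) (hb : 0 ≤ b) (hc : 0 ≤ c) (h : a + b + c = 1)
    (hz : a • P + b • Q + c • R = z) : z ∈ convexHull ℝ ({P, Q, R} : Set E) := by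
  have hP : P ∈ convexHull ℝ ({P, Q, R} : Set E) := subset_convexHull ℝ _ (by simp)
  have hQ : Q ∈ convexHull ℝ ({P, Q, R} : Set E) := subset_convexHull ℝ _ (by simp)
  have hR : R ∈ convexHull ℝ ({P, Q, R} : Set E) := subset_convexHull ℝ _ (by simp)
  rw [← hz]
  have := (convex_convexHull ℝ ({P, Q, R} : Set E)).sum_mem (t := Finset.univ)
    (w := ![a, b, c]) (z := ![P, Q, R])
    (by intro i _; fin_cases i <;> simpa) (by simp [Fin.sum_univ_three, h])
    (by intro i _; fin_cases i <;> simpa)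
  simpa [Fin.sum_univ_three] using this

theorem integral_tent {α : ℝ} (h0 : 0 < α) (h1 : α < 1) :
    ∫⁻ x : ℝ, ENNReal.ofReal (min (x / α) ((1 - x) / (1 - α))) = ENNReal.ofReal (1 / 2) := by
  have h1' : 0 < 1 - α := sub_pos.2 h1
  have hc : Continuous fun x : ℝ => min (x / α) ((1 - x) / (1 - α)) := by fun_prop
  have hind : ∀ x : ℝ, ENNReal.ofReal (min (x / α) ((1 - x) / (1 - α))) =
      (Set.Ioo (0 : ℝ) 1).indicator
        (fun x => ENNReal.ofReal (min (x / α) ((1 - x) / (1 - α)))) x := by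
    intro x
    by_cases hx : x ∈ Set.Ioo (0 : ℝ) 1
    · rw [Set.indicator_of_mem hx]
    · rw [Set.indicator_of_notMem hx, ENNReal.ofReal_eq_zero]
      by_contra hlt
      rw [not_le, lt_min_iff, div_pos_iff_of_pos_right h0, div_pos_iff_of_pos_right h1'] at hlt
      exact hx ⟨hlt.1, by linarith [hlt.2]⟩
  rw [lintegral_congr hind, lintegral_indicator measurableSet_Ioo, lintegral_Ioo_ofReal zero_le_one hc]
  · congr 1
    rw [← intervalIntegral.integral_add_adjacent_intervals (b := α) (hc.intervalIntegrable _ _)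
      (hc.intervalIntegrable _ _)]
    have e1 : ∫ x in (0 : ℝ)..α, min (x / α) ((1 - x) / (1 - α)) = ∫ x in (0 : ℝ)..α, x / α := by
      refine intervalIntegral.integral_congr fun x hx => min_eq_left ?_
      rw [Set.uIcc_of_le h0.le] at hx
      rw [div_le_div_iff₀ h0 h1']
      nlinarith [hx.2]
    have e2 : ∫ x in α..1, min (x / α) ((1 - x) / (1 - α)) =
        ∫ x in α..1, (1 - x) / (1 - α) := by
      refine intervalIntegral.integral_congr fun x hx => min_eq_right ?_
      rw [Set.uIcc_of_le h1.le] at hx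
      rw [div_le_div_iff₀ h1' h0]
      nlinarith [hx.1]
    rw [e1, e2, intervalIntegral.integral_div, intervalIntegral.integral_div,
      intervalIntegral.integral_sub (by simp) (by simp)]
    simp only [integral_id, intervalIntegral.integral_const, smul_eq_mul]
    field_simp
    ring
  · intro x hx
    have := hx.1
    have : 0 < 1 - x := sub_pos.2 hx.2
    positivity

theorem convexHull_kite {α β : ℝ} (ha0 : 0 < α) (ha1 : α < 1) (hb0 : 0 < β) (hb1 : β < 1) :
    convexHull ℝ ({(0, β), (α, 0), (1, β), (α, 1)} : Set (ℝ × ℝ)) =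
      {z | β - β * min (z.1 / α) ((1 - z.1) / (1 - α)) ≤ z.2 ∧
        z.2 ≤ β + (1 - β) * min (z.1 / α) ((1 - z.1) / (1 - α))} := by
  have ha1' : 0 < 1 - α := sub_pos.2 ha1
  have hb1' : 0 < 1 - β := sub_pos.2 hb1
  apply Set.Subset.antisymm
  · have hconv := (((convex_halfPlane (-β / α) (-1) (-β)).inter
      (convex_halfPlane (β / (1 - α)) (-1) (β / (1 - α) - β))).inter
      (convex_halfPlane (-(1 - β) / α) 1 β)).inter
      (convex_halfPlane ((1 - β) / (1 - α)) 1 (β + (1 - β) / (1 - α)))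
    intro z hz
    have hz' := convexHull_min ?_ hconv hz
    · obtain ⟨⟨⟨g1, g2⟩, g3⟩, g4⟩ := hz'
      simp only [Set.mem_ofPred_eq] at g1 g2 g3 g4 ⊢
      rcases min_choice (z.1 / α) ((1 - z.1) / (1 - α)) with h | h
      · rw [h]
        constructor
        · have : -β / α * z.1 = - (β * (z.1 / α)) := by ring
          linarith
        · have : -(1 - β) / α * z.1 = - ((1 - β) * (z.1 / α)) := by ring
          linarith
      · rw [h]
        constructor
        · have : β / (1 - α) * z.1 - β / (1 - α) = - (β * ((1 - z.1) / (1 - α))) := by ring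
          linarith
        · have : (1 - β) / (1 - α) * z.1 - (1 - β) / (1 - α) =
            - ((1 - β) * ((1 - z.1) / (1 - α))) := by ring
          linarith
    · intro z hz
      have hpos : 0 ≤ β / (1 - α) := by positivity
      have hpos2 : 0 ≤ (1 - β) / (1 - α) := by positivity
      have hpos3 : 0 ≤ β / α := by positivity
      have hpos4 : 0 ≤ (1 - β) / α := by positivity
      have k1 : β / (1 - α) * α = β / (1 - α) - β := by field_simp; ring
      have k2 : (1 - β) / (1 - α) * α = (1 - β) / (1 - α) - (1 - β) := by field_simp; ring
      have k3 : -β / α * α = -β := by field_simp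
      have k4 : -(1 - β) / α * α = -(1 - β) := by field_simp
      have k5 : β / α * (1 - α) = β / α - β := by field_simp
      have k6 : (1 - β) / α * (1 - α) = (1 - β) / α - (1 - β) := by field_simp
      have k5' : 0 ≤ β / α - β := by rw [← k5]; positivity
      have k6' : 0 ≤ (1 - β) / α - (1 - β) := by rw [← k6]; positivity
      have k7 : -β / α = -(β / α) := by ring
      have k8 : -(1 - β) / α = -((1 - β) / α) := by ring
      have k1' : 0 ≤ β / (1 - α) - β := by rw [← k1]; positivity
      have k2' : 0 ≤ (1 - β) / (1 - α) - (1 - β) := by rw [← k2]; positivity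
      simp only [Set.mem_insert_iff, Set.mem_singleton_iff] at hz
      simp only [Set.mem_inter_iff, Set.mem_ofPred_eq]
      rcases hz with rfl | rfl | rfl | rfl <;> dsimp only
      · refine ⟨⟨⟨?_, ?_⟩, ?_⟩, ?_⟩ <;> linarith
      · refine ⟨⟨⟨?_, ?_⟩, ?_⟩, ?_⟩ <;> linarith
      · refine ⟨⟨⟨?_, ?_⟩, ?_⟩, ?_⟩ <;> linarith
      · refine ⟨⟨⟨?_, ?_⟩, ?_⟩, ?_⟩ <;> linarith
  · rintro ⟨x, y⟩ ⟨h1, h2⟩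
    dsimp only at h1 h2
    rcases le_total x α with hx | hx
    · have hle : x / α ≤ (1 - x) / (1 - α) := by
        rw [div_le_div_iff₀ ha0 ha1']; nlinarith
      rw [min_eq_left hle] at h1 h2
      have hs : x / α ≤ 1 := by rw [div_le_one ha0]; exact hx
      have hsx : x / α * α = x := by field_simp
      refine convexHull_mono ?_ (mem_convexHull_triple (P := ((0 : ℝ), β)) (Q := (α, (1 : ℝ)))
        (R := (α, (0 : ℝ))) (a := 1 - x / α) (b := y - β * (1 - x / α))
        (c := x / α - (y - β * (1 - x / α))) ?_ ?_ ?_ ?_ ?_)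
      · intro z hz
        simp only [Set.mem_insert_iff, Set.mem_singleton_iff] at hz ⊢
        tauto
      · linarith
      · linarith
      · linarith
      · ring
      · ext
        · simp only [Prod.fst_add, Prod.smul_mk, smul_eq_mul]; linarith
        · simp only [Prod.snd_add, Prod.smul_mk, smul_eq_mul]; ring
    · have hle : (1 - x) / (1 - α) ≤ x / α := by
        rw [div_le_div_iff₀ ha1' ha0]; nlinarith
      rw [min_eq_right hle] at h1 h2
      have hs : (1 - x) / (1 - α) ≤ 1 := by rw [div_le_one ha1']; linarith
      have hsx : (1 - x) / (1 - α) * (1 - α) = 1 - x := by field_simp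
      set s := (1 - x) / (1 - α)
      refine convexHull_mono ?_ (mem_convexHull_triple (P := ((1 : ℝ), β)) (Q := (α, (1 : ℝ)))
        (R := (α, (0 : ℝ))) (a := 1 - s) (b := y - β * (1 - s))
        (c := s - (y - β * (1 - s))) ?_ ?_ ?_ ?_ ?_)
      · intro z hz
        simp only [Set.mem_insert_iff, Set.mem_singleton_iff] at hz ⊢
        tauto
      · linarith
      · linarith
      · linarith
      · ring
      · ext
        · simp only [Prod.fst_add, Prod.smul_mk, smul_eq_mul]; linarith
        · simp only [Prod.snd_add, Prod.smul_mk, smul_eq_mul]; ring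

theorem volume_convexHull_kite {α β : ℝ} (ha0 : 0 < α) (ha1 : α < 1) (hb0 : 0 < β) (hb1 : β < 1) :
    volume (convexHull ℝ ({(0, β), (α, 0), (1, β), (α, 1)} : Set (ℝ × ℝ))) =
      ENNReal.ofReal (1 / 2) := by
  rw [convexHull_kite ha0 ha1 hb0 hb1, Measure.volume_eq_prod, Measure.prod_apply]
  · rw [← integral_tent ha0 ha1]
    refine lintegral_congr fun x => ?_
    have : (Prod.mk x ⁻¹' {z : ℝ × ℝ | β - β * min (z.1 / α) ((1 - z.1) / (1 - α)) ≤ z.2 ∧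
        z.2 ≤ β + (1 - β) * min (z.1 / α) ((1 - z.1) / (1 - α))}) =
        Set.Icc (β - β * min (x / α) ((1 - x) / (1 - α)))
          (β + (1 - β) * min (x / α) ((1 - x) / (1 - α))) := rfl
    rw [this, Real.volume_Icc]
    congr 1
    ring
  · rw [← convexHull_kite ha0 ha1 hb0 hb1]
    exact (Set.Finite.isCompact_convexHull ℝ (by simp)).isClosed.measurableSet

/-- The area of a convex quadrilateral in terms of its diagonals. -/
theorem volume_convexHull_of_crossing {A B C D : ℝ × ℝ} {α β : ℝ} (ha0 : 0 < α) (ha1 : α < 1)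
    (hb0 : 0 < β) (hb1 : β < 1) (h1 : A.1 + α * (C.1 - A.1) = B.1 + β * (D.1 - B.1))
    (h2 : A.2 + α * (C.2 - A.2) = B.2 + β * (D.2 - B.2))
    (hκ : (C.1 - A.1) * (D.2 - B.2) - (D.1 - B.1) * (C.2 - A.2) ≠ 0) :
    volume (convexHull ℝ ({A, B, C, D} : Set (ℝ × ℝ))) =
      ENNReal.ofReal (|(C.1 - A.1) * (D.2 - B.2) - (D.1 - B.1) * (C.2 - A.2)| / 2) := by
  have hmeas : MeasurableSet (convexHull ℝ ({A, B, C, D} : Set (ℝ × ℝ))) :=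
    (Set.Finite.isCompact_convexHull ℝ (by simp)).isClosed.measurableSet
  rw [volume_affine_plane_preimage hκ (A.1 - β * (D.1 - B.1)) (A.2 - β * (D.2 - B.2)) hmeas]
  set ψ : ℝ × ℝ →ᵃ[ℝ] ℝ × ℝ := (Matrix.toLin (Module.Basis.finTwoProd ℝ)
    (Module.Basis.finTwoProd ℝ)
      !![C.1 - A.1, D.1 - B.1; C.2 - A.2, D.2 - B.2]).toAffineMap +
      AffineMap.const ℝ (ℝ × ℝ) (A.1 - β * (D.1 - B.1), A.2 - β * (D.2 - B.2)) with hψ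
  have hψa : ∀ z : ℝ × ℝ, ψ z = ((C.1 - A.1) * z.1 + (D.1 - B.1) * z.2 + (A.1 - β * (D.1 - B.1)),
      (C.2 - A.2) * z.1 + (D.2 - B.2) * z.2 + (A.2 - β * (D.2 - B.2))) := by
    intro z
    simp [hψ, Matrix.toLin_finTwoProd_apply]
  have himg : ({A, B, C, D} : Set (ℝ × ℝ)) = ψ '' {(0, β), (α, 0), (1, β), (α, 1)} := by
    have eA : ψ (0, β) = A := by rw [hψa]; ext <;> dsimp only <;> ring
    have eC : ψ (1, β) = C := by rw [hψa]; ext <;> dsimp only <;> ring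
    have eB : ψ (α, 0) = B := by rw [hψa]; ext <;> dsimp only <;> linarith
    have eD : ψ (α, 1) = D := by rw [hψa]; ext <;> dsimp only <;> linarith
    simp only [Set.image_insert_eq, Set.image_singleton, eA, eB, eC, eD]
  have hinj : Function.Injective ψ := by
    intro z w hzw
    rw [hψa, hψa, Prod.mk.injEq] at hzw
    obtain ⟨e1, e2⟩ := hzw
    ext
    · refine mul_left_cancel₀ hκ ?_
      linear_combination (D.2 - B.2) * e1 - (D.1 - B.1) * e2
    · refine mul_left_cancel₀ hκ ?_
      linear_combination (C.1 - A.1) * e2 - (C.2 - A.2) * e1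
  have hpre : {z : ℝ × ℝ | ((C.1 - A.1) * z.1 + (D.1 - B.1) * z.2 + (A.1 - β * (D.1 - B.1)),
      (C.2 - A.2) * z.1 + (D.2 - B.2) * z.2 + (A.2 - β * (D.2 - B.2))) ∈
      convexHull ℝ ({A, B, C, D} : Set (ℝ × ℝ))} =
      convexHull ℝ {(0, β), (α, 0), (1, β), (α, 1)} := by
    ext z
    rw [Set.mem_ofPred_eq, ← hψa, himg, ← AffineMap.image_convexHull, hinj.mem_set_image]
  rw [hpre, volume_convexHull_kite ha0 ha1 hb0 hb1, ← ENNReal.ofReal_mul (abs_nonneg _)]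
  congr 1
  ring

theorem notMem_convexHull_of_crossing {A B C D : ℝ × ℝ} {α β : ℝ} (ha0 : 0 < α) (ha1 : α < 1)
    (h1 : A.1 + α * (C.1 - A.1) = B.1 + β * (D.1 - B.1))
    (h2 : A.2 + α * (C.2 - A.2) = B.2 + β * (D.2 - B.2))
    (hκ : (C.1 - A.1) * (D.2 - B.2) - (D.1 - B.1) * (C.2 - A.2) ≠ 0) :
    A ∉ convexHull ℝ ({B, C, D} : Set (ℝ × ℝ)) := by
  set κ := (C.1 - A.1) * (D.2 - B.2) - (D.1 - B.1) * (C.2 - A.2) with hκdef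
  have hsq : 0 < κ ^ 2 := by positivity
  intro hA
  have hmem := convexHull_min (t := {z : ℝ × ℝ | -((D.2 - B.2) * κ) * z.1 + ((D.1 - B.1) * κ) * z.2
    ≤ -((D.2 - B.2) * κ) * A.1 + ((D.1 - B.1) * κ) * A.2 - α * κ ^ 2}) ?_ (convex_halfPlane _ _ _) hA
  · simp only [Set.mem_ofPred_eq] at hmem
    nlinarith
  · have eB : -((D.2 - B.2) * κ) * B.1 + ((D.1 - B.1) * κ) * B.2 =
        -((D.2 - B.2) * κ) * A.1 + ((D.1 - B.1) * κ) * A.2 - α * κ ^ 2 := by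
      rw [hκdef]
      linear_combination (κ * (D.2 - B.2)) * h1 - (κ * (D.1 - B.1)) * h2
    intro z hz
    simp only [Set.mem_insert_iff, Set.mem_singleton_iff] at hz
    rcases hz with rfl | rfl | rfl
    · exact eB.le
    · have : -((D.2 - B.2) * κ) * z.1 + ((D.1 - B.1) * κ) * z.2 =
        -((D.2 - B.2) * κ) * A.1 + ((D.1 - B.1) * κ) * A.2 - κ ^ 2 := by
        rw [hκdef]; ring
      simp only [Set.mem_ofPred_eq]
      rw [this]
      nlinarith
    · refine le_of_eq (Eq.trans ?_ eB)
      ring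

/-- An indexed family is in convex position if no member lies in the convex hull of the others. -/
def ConvexFamily {ι E : Type*} [AddCommGroup E] [Module ℝ E] (y : ι → E) : Prop :=
  ∀ i, y i ∉ convexHull ℝ (y '' {i}ᶜ)

theorem convexFamily_four_iff {E : Type*} [AddCommGroup E] [Module ℝ E] {p r s q : E} :
    ConvexFamily ![p, r, s, q] ↔ p ∉ convexHull ℝ {r, s, q} ∧ r ∉ convexHull ℝ {p, s, q} ∧
      s ∉ convexHull ℝ {p, r, q} ∧ q ∉ convexHull ℝ {p, r, s} := by
  have h0 : ({0}ᶜ : Set (Fin 4)) = {1, 2, 3} := by ext i; fin_cases i <;> simp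
  have h1 : ({1}ᶜ : Set (Fin 4)) = {0, 2, 3} := by ext i; fin_cases i <;> simp
  have h2 : ({2}ᶜ : Set (Fin 4)) = {0, 1, 3} := by ext i; fin_cases i <;> simp
  have h3 : ({3}ᶜ : Set (Fin 4)) = {0, 1, 2} := by ext i; fin_cases i <;> simp
  simp [ConvexFamily, Fin.forall_fin_succ, h0, h1, h2, h3, Set.image_insert_eq]

theorem convexFamily_of_crossing {A B C D : ℝ × ℝ} {α β : ℝ} (ha0 : 0 < α) (ha1 : α < 1)
    (hb0 : 0 < β) (hb1 : β < 1) (h1 : A.1 + α * (C.1 - A.1) = B.1 + β * (D.1 - B.1))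
    (h2 : A.2 + α * (C.2 - A.2) = B.2 + β * (D.2 - B.2))
    (hκ : (C.1 - A.1) * (D.2 - B.2) - (D.1 - B.1) * (C.2 - A.2) ≠ 0) :
    ConvexFamily ![A, B, C, D] := by
  rw [convexFamily_four_iff]
  refine ⟨notMem_convexHull_of_crossing ha0 ha1 h1 h2 hκ, ?_, ?_, ?_⟩
  · have := notMem_convexHull_of_crossing (A := B) (B := A) (C := D) (D := C) hb0 hb1 h1.symm
      h2.symm (by contrapose! hκ; linarith)
    rwa [Set.pair_comm C D]
  · have := notMem_convexHull_of_crossing (A := C) (B := B) (C := A) (D := D) (α := 1 - α) (β := β)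
      (by linarith) (by linarith) (by linarith) (by linarith) (by contrapose! hκ; linarith)
    rwa [Set.insert_comm]
  · have := notMem_convexHull_of_crossing (A := D) (B := A) (C := B) (D := C) (α := 1 - β) (β := α)
      (by linarith) (by linarith) (by linarith) (by linarith) (by contrapose! hκ; linarith)
    exact this

theorem range_four {E : Type*} (p r s q : E) : Set.range ![p, r, s, q] = {p, r, s, q} := by
  simp only [Matrix.range_cons, Matrix.range_empty, Set.union_empty, Set.singleton_union]

/-- The affine frame of the plane sending `(0, 0)` to `p` and `(1, 0)` to `q`, with vertical
second axis, and scaling the area by `1 / N`. -/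
noncomputable def quadFrame (p q : ℝ × ℝ) (N : ℝ) (z : ℝ × ℝ) : ℝ × ℝ :=
  (p.1 + z.1 * (q.1 - p.1), p.2 + z.1 * (q.2 - p.2) + z.2 / (N * (q.1 - p.1)))

section

variable {p q : ℝ × ℝ} {N t₁ t₂ w₁ w₂ : ℝ}

theorem quadFrame_opposite (hpq : p.1 < q.1) (hN : 0 < N) (h0 : 0 < t₁) (h1 : t₁ < t₂)
    (h2 : t₂ < 1) (hw : (0 < w₁ ∧ w₂ < 0) ∨ (w₁ < 0 ∧ 0 < w₂)) :
    ConvexFamily ![p, quadFrame p q N (t₁, w₁), quadFrame p q N (t₂, w₂), q] ∧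
    volume (convexHull ℝ
      (Set.range ![p, quadFrame p q N (t₁, w₁), quadFrame p q N (t₂, w₂), q])) =
      ENNReal.ofReal (|w₁ - w₂| / 2 / N) := by
  have hL : 0 < q.1 - p.1 := sub_pos.2 hpq
  have hL' : q.1 - p.1 ≠ 0 := hL.ne'
  have hd : w₁ - w₂ ≠ 0 := by rcases hw with h | h <;> [linarith [h.1, h.2]; skip]; linarith [h.1, h.2]
  set β := w₁ / (w₁ - w₂) with hβ
  have hβd : β * (w₁ - w₂) = w₁ := by rw [hβ]; field_simp
  have hb0 : 0 < β := by
    rcases hw with h | h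
    · exact div_pos h.1 (by linarith [h.1, h.2])
    · exact div_pos_of_neg_of_neg h.1 (by linarith [h.1, h.2])
  have hb1 : β < 1 := by
    rcases hw with h | h
    · rw [hβ, div_lt_one (by linarith [h.1, h.2])]; linarith [h.1, h.2]
    · rw [hβ, div_lt_one_of_neg (by linarith [h.1, h.2])]; linarith [h.1, h.2]
  have ha0 : 0 < t₁ + β * (t₂ - t₁) := by have := sub_pos.2 h1; positivity
  have ha1 : t₁ + β * (t₂ - t₁) < 1 := by nlinarith
  set r := quadFrame p q N (t₁, w₁) with hr
  set s := quadFrame p q N (t₂, w₂) with hs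
  have e1 : p.1 + (t₁ + β * (t₂ - t₁)) * (q.1 - p.1) = r.1 + β * (s.1 - r.1) := by
    simp only [hr, hs, quadFrame]; ring
  have e2 : p.2 + (t₁ + β * (t₂ - t₁)) * (q.2 - p.2) = r.2 + β * (s.2 - r.2) := by
    have : r.2 + β * (s.2 - r.2) = p.2 + (t₁ + β * (t₂ - t₁)) * (q.2 - p.2) +
        (w₁ - β * (w₁ - w₂)) / (N * (q.1 - p.1)) := by
      simp only [hr, hs, quadFrame]; ring
    rw [this, hβd]; simp
  have eκ : (q.1 - p.1) * (s.2 - r.2) - (s.1 - r.1) * (q.2 - p.2) = -((w₁ - w₂) / N) := by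
    simp only [hr, hs, quadFrame]; field_simp; ring
  have hκ : (q.1 - p.1) * (s.2 - r.2) - (s.1 - r.1) * (q.2 - p.2) ≠ 0 := by
    rw [eκ]; exact neg_ne_zero.2 (div_ne_zero hd hN.ne')
  constructor
  · have := convexFamily_of_crossing ha0 ha1 hb0 hb1 e1 e2 hκ
    rw [convexFamily_four_iff] at this ⊢
    obtain ⟨i1, i2, i3, i4⟩ := this
    refine ⟨?_, ?_, ?_, ?_⟩
    · rwa [Set.pair_comm s q]
    · rwa [Set.pair_comm s q]
    · exact i4
    · exact i3
  · rw [range_four, Set.pair_comm s q, volume_convexHull_of_crossing ha0 ha1 hb0 hb1 e1 e2 hκ, eκ,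
      abs_neg, abs_div, abs_of_pos hN]
    congr 1
    ring

theorem quadFrame_same (hpq : p.1 < q.1) (hN : 0 < N) (h0 : 0 < t₁) (h1 : t₁ < t₂)
    (h2 : t₂ < 1) (hw : (t₁ * w₂ < t₂ * w₁ ∧ (1 - t₂) * w₁ < (1 - t₁) * w₂) ∨
      (t₂ * w₁ < t₁ * w₂ ∧ (1 - t₁) * w₂ < (1 - t₂) * w₁)) :
    ConvexFamily ![p, quadFrame p q N (t₁, w₁), quadFrame p q N (t₂, w₂), q] ∧
    volume (convexHull ℝ
      (Set.range ![p, quadFrame p q N (t₁, w₁), quadFrame p q N (t₂, w₂), q])) =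
      ENNReal.ofReal (|t₂ * w₁ + (1 - t₁) * w₂| / 2 / N) := by
  have hL : 0 < q.1 - p.1 := sub_pos.2 hpq
  have hL' : q.1 - p.1 ≠ 0 := hL.ne'
  have ht : 0 < t₂ - t₁ := sub_pos.2 h1
  set Δ := t₂ * w₁ + (1 - t₁) * w₂ with hΔ
  have main : 0 < w₁ / Δ ∧ w₁ / Δ < 1 ∧ 0 < w₂ / Δ ∧ w₂ / Δ < 1 ∧ Δ ≠ 0 := by
    rcases hw with ⟨g1, g2⟩ | ⟨g1, g2⟩
    · have hw2 : 0 < w₂ := by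
        have : 0 < (t₂ - t₁) * w₂ := by nlinarith
        exact (mul_pos_iff_of_pos_left ht).1 this
      have hw1 : 0 < w₁ := by
        have : 0 < (t₂ - t₁) * w₁ := by nlinarith
        exact (mul_pos_iff_of_pos_left ht).1 this
      have hΔ0 : 0 < Δ := by nlinarith
      refine ⟨by positivity, ?_, by positivity, ?_, hΔ0.ne'⟩
      · rw [div_lt_one hΔ0]; linarith
      · rw [div_lt_one hΔ0]; linarith
    · have hw2 : w₂ < 0 := by
        have : 0 < (t₂ - t₁) * (-w₂) := by nlinarith
        linarith [(mul_pos_iff_of_pos_left ht).1 this]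
      have hw1 : w₁ < 0 := by
        have : 0 < (t₂ - t₁) * (-w₁) := by nlinarith
        linarith [(mul_pos_iff_of_pos_left ht).1 this]
      have hΔ0 : Δ < 0 := by nlinarith
      refine ⟨div_pos_of_neg_of_neg hw1 hΔ0, ?_, div_pos_of_neg_of_neg hw2 hΔ0, ?_, hΔ0.ne⟩
      · rw [div_lt_one_of_neg hΔ0]; linarith
      · rw [div_lt_one_of_neg hΔ0]; linarith
  obtain ⟨ha0, ha1, hb1, hb0, hd⟩ := main
  have hb0 : 0 < 1 - w₂ / Δ := by linarith
  have hb1 : 1 - w₂ / Δ < 1 := by linarith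
  set r := quadFrame p q N (t₁, w₁) with hr
  set s := quadFrame p q N (t₂, w₂) with hs
  have k : w₁ / Δ * t₂ = t₁ + (1 - w₂ / Δ) * (1 - t₁) := by
    field_simp; rw [hΔ]; ring
  have e1 : p.1 + w₁ / Δ * (s.1 - p.1) = r.1 + (1 - w₂ / Δ) * (q.1 - r.1) := by
    simp only [hr, hs, quadFrame]
    linear_combination (q.1 - p.1) * k
  have e2 : p.2 + w₁ / Δ * (s.2 - p.2) = r.2 + (1 - w₂ / Δ) * (q.2 - r.2) := by
    simp only [hr, hs, quadFrame]
    linear_combination (q.2 - p.2) * k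
  have eκ : (s.1 - p.1) * (q.2 - r.2) - (q.1 - r.1) * (s.2 - p.2) = -(Δ / N) := by
    simp only [hr, hs, quadFrame, hΔ]; field_simp; ring
  have hκ : (s.1 - p.1) * (q.2 - r.2) - (q.1 - r.1) * (s.2 - p.2) ≠ 0 := by
    rw [eκ]; exact neg_ne_zero.2 (div_ne_zero hd hN.ne')
  refine ⟨convexFamily_of_crossing ha0 ha1 hb0 hb1 e1 e2 hκ, ?_⟩
  rw [range_four, volume_convexHull_of_crossing ha0 ha1 hb0 hb1 e1 e2 hκ, eκ,
      abs_neg, abs_div, abs_of_pos hN]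
  congr 1
  ring

theorem quadFrame_not_convexFamily_left (h0 : 0 < t₁) (h1 : t₁ < t₂) (h2 : t₂ < 1) {x : ℝ}
    (hx : 0 ≤ x) (hxt : x * t₂ ≤ t₁) (hw : w₁ = x * w₂) :
    ¬ ConvexFamily ![p, quadFrame p q N (t₁, w₁), quadFrame p q N (t₂, w₂), q] := by
  rw [convexFamily_four_iff]
  rintro ⟨-, h, -, -⟩
  refine h (mem_convexHull_triple (a := 1 - t₁ - x * (1 - t₂)) (b := x) (c := t₁ - x * t₂)
    ?_ hx (by linarith) (by ring) ?_)
  · have : 0 < t₂ := h0.trans h1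
    have hx1 : x ≤ 1 := by nlinarith
    nlinarith
  · ext
    · simp only [quadFrame, Prod.fst_add, Prod.smul_fst, smul_eq_mul]; ring
    · simp only [quadFrame, Prod.snd_add, Prod.smul_snd, smul_eq_mul, hw]; ring

theorem quadFrame_not_convexFamily_right (h0 : 0 < t₁) (h1 : t₁ < t₂) (h2 : t₂ < 1) {x : ℝ}
    (hx : 0 ≤ x) (hxt : x * (1 - t₁) ≤ 1 - t₂) (hw : w₂ = x * w₁) :
    ¬ ConvexFamily ![p, quadFrame p q N (t₁, w₁), quadFrame p q N (t₂, w₂), q] := by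
  rw [convexFamily_four_iff]
  rintro ⟨-, -, h, -⟩
  refine h (mem_convexHull_triple (a := 1 - t₂ - x * (1 - t₁)) (b := x) (c := t₂ - x * t₁)
    (by linarith) hx ?_ (by ring) ?_)
  · have hx1 : x ≤ 1 := by nlinarith
    nlinarith
  · ext
    · simp only [quadFrame, Prod.fst_add, Prod.smul_fst, smul_eq_mul]; ring
    · simp only [quadFrame, Prod.snd_add, Prod.smul_snd, smul_eq_mul, hw]; ring

open Classical in
/-- In the frame `quadFrame p q N`, the weight of a quadrilateral with leftmost vertex `p` and
rightmost vertex `q` is given by `quadWeight`. -/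
theorem quadWeight_quadFrame (hpq : p.1 < q.1) (hN : 0 < N) (φ : ENNReal → ENNReal) :
    (if (p.1 < (quadFrame p q N (t₁, w₁)).1 ∧
        (quadFrame p q N (t₁, w₁)).1 < (quadFrame p q N (t₂, w₂)).1 ∧
        (quadFrame p q N (t₂, w₂)).1 < q.1) ∧
        ConvexFamily ![p, quadFrame p q N (t₁, w₁), quadFrame p q N (t₂, w₂), q] then
      φ (volume (convexHull ℝ
        (Set.range ![p, quadFrame p q N (t₁, w₁), quadFrame p q N (t₂, w₂), q]))) else 0) =
      quadWeight (fun a => φ (ENNReal.ofReal (a / N))) t₁ t₂ w₁ w₂ := by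
  have hL : 0 < q.1 - p.1 := sub_pos.2 hpq
  have hsort : (p.1 < (quadFrame p q N (t₁, w₁)).1 ∧
        (quadFrame p q N (t₁, w₁)).1 < (quadFrame p q N (t₂, w₂)).1 ∧
        (quadFrame p q N (t₂, w₂)).1 < q.1) ↔ 0 < t₁ ∧ t₁ < t₂ ∧ t₂ < 1 := by
    simp only [quadFrame]
    refine and_congr ?_ (and_congr ?_ ?_)
    · rw [lt_add_iff_pos_right, mul_pos_iff_of_pos_right hL]
    · rw [add_lt_add_iff_left, mul_lt_mul_iff_left₀ hL]
    · constructor <;> intro h <;> nlinarith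
  simp only [hsort]
  unfold quadWeight
  by_cases ht : 0 < t₁ ∧ t₁ < t₂ ∧ t₂ < 1
  swap
  · simp [ht]
  obtain ⟨h0, h1, h2⟩ := ht
  have ht : 0 < t₂ - t₁ := sub_pos.2 h1
  have ht2 : 0 < t₂ := h0.trans h1
  have ht1 : 0 < 1 - t₁ := by linarith
  have hpos3 : t₁ * w₂ < t₂ * w₁ ∧ (1 - t₂) * w₁ < (1 - t₁) * w₂ → 0 < w₁ ∧ 0 < w₂ := by
    rintro ⟨g1, g2⟩
    have a1 : 0 < (t₂ - t₁) * w₁ := by nlinarith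
    have a2 : 0 < (t₂ - t₁) * w₂ := by nlinarith
    exact ⟨(mul_pos_iff_of_pos_left ht).1 a1, (mul_pos_iff_of_pos_left ht).1 a2⟩
  have hpos4 : t₂ * w₁ < t₁ * w₂ ∧ (1 - t₁) * w₂ < (1 - t₂) * w₁ → w₁ < 0 ∧ w₂ < 0 := by
    rintro ⟨g1, g2⟩
    have a1 : 0 < (t₂ - t₁) * (-w₁) := by nlinarith
    have a2 : 0 < (t₂ - t₁) * (-w₂) := by nlinarith
    exact ⟨by linarith [(mul_pos_iff_of_pos_left ht).1 a1],
      by linarith [(mul_pos_iff_of_pos_left ht).1 a2]⟩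
  simp only [h0, h1, h2, and_self, true_and, if_true]
  by_cases r1 : 0 < w₁ ∧ w₂ < 0
  · obtain ⟨hc, hv⟩ := quadFrame_opposite hpq hN h0 h1 h2 (Or.inl r1)
    have n2 : ¬ (w₁ < 0 ∧ 0 < w₂) := fun h => by linarith [h.1, r1.1]
    have n3 := mt hpos3 (fun h => by linarith [h.2, r1.2])
    have n4 := mt hpos4 (fun h => by linarith [h.1, r1.1])
    rw [if_pos hc, hv, if_pos r1, if_neg n2, if_neg n3, if_neg n4,
      abs_of_pos (by linarith [r1.1, r1.2])]
    simp
  by_cases r2 : w₁ < 0 ∧ 0 < w₂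
  · obtain ⟨hc, hv⟩ := quadFrame_opposite hpq hN h0 h1 h2 (Or.inr r2)
    have n3 := mt hpos3 (fun h => by linarith [h.1, r2.1])
    have n4 := mt hpos4 (fun h => by linarith [h.2, r2.2])
    rw [if_pos hc, hv, if_neg r1, if_pos r2, if_neg n3, if_neg n4,
      abs_of_neg (by linarith [r2.1, r2.2]), neg_sub]
    simp
  by_cases r3 : t₁ * w₂ < t₂ * w₁ ∧ (1 - t₂) * w₁ < (1 - t₁) * w₂
  · obtain ⟨hc, hv⟩ := quadFrame_same hpq hN h0 h1 h2 (Or.inl r3)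
    obtain ⟨g1, g2⟩ := hpos3 r3
    have n4 := mt hpos4 (fun h => by linarith [h.2, g2])
    rw [if_pos hc, hv, if_neg r1, if_neg r2, if_pos r3, if_neg n4, abs_of_pos (by positivity)]
    simp
  by_cases r4 : t₂ * w₁ < t₁ * w₂ ∧ (1 - t₁) * w₂ < (1 - t₂) * w₁
  · obtain ⟨hc, hv⟩ := quadFrame_same hpq hN h0 h1 h2 (Or.inr r4)
    obtain ⟨g1, g2⟩ := hpos4 r4
    rw [if_pos hc, hv, if_neg r1, if_neg r2, if_neg r3, if_pos r4, abs_of_neg (by nlinarith)]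
    simp
  have hnot : ¬ ConvexFamily ![p, quadFrame p q N (t₁, w₁), quadFrame p q N (t₂, w₂), q] := by
    rcases lt_trichotomy w₁ 0 with g1 | g1 | g1
    · rcases lt_trichotomy w₂ 0 with g2 | g2 | g2
      · rw [not_and_or, not_lt, not_lt] at r4
        rcases r4 with r4 | r4
        · refine quadFrame_not_convexFamily_left h0 h1 h2 (x := w₁ / w₂)
            (div_pos_of_neg_of_neg g1 g2).le ?_ (by rw [div_mul_cancel₀ _ g2.ne])
          rw [div_mul_eq_mul_div, div_le_iff_of_neg g2]
          linarith
        · refine quadFrame_not_convexFamily_right h0 h1 h2 (x := w₂ / w₁)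
            (div_pos_of_neg_of_neg g2 g1).le ?_ (by rw [div_mul_cancel₀ _ g1.ne])
          rw [div_mul_eq_mul_div, div_le_iff_of_neg g1]
          linarith
      · exact quadFrame_not_convexFamily_right h0 h1 h2 le_rfl (by linarith) (by simp [g2])
      · exact absurd ⟨g1, g2⟩ r2
    · exact quadFrame_not_convexFamily_left h0 h1 h2 le_rfl (by linarith) (by simp [g1])
    · rcases lt_trichotomy w₂ 0 with g2 | g2 | g2
      · exact absurd ⟨g1, g2⟩ r1
      · exact quadFrame_not_convexFamily_right h0 h1 h2 le_rfl (by linarith) (by simp [g2])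
      · rw [not_and_or, not_lt, not_lt] at r3
        rcases r3 with r3 | r3
        · refine quadFrame_not_convexFamily_left h0 h1 h2 (x := w₁ / w₂)
            (div_pos g1 g2).le ?_ (by rw [div_mul_cancel₀ _ g2.ne'])
          rw [div_mul_eq_mul_div, div_le_iff₀ g2]
          linarith
        · refine quadFrame_not_convexFamily_right h0 h1 h2 (x := w₂ / w₁)
            (div_pos g2 g1).le ?_ (by rw [div_mul_cancel₀ _ g1.ne'])
          rw [div_mul_eq_mul_div, div_le_iff₀ g1]
          linarith
  rw [if_neg hnot, if_neg r1, if_neg r2, if_neg r3, if_neg r4]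
  simp

end

theorem quadWeight_eq_zero_or_eq_apply (t₁ t₂ w₁ w₂ : ℝ) :
    (∀ φ, quadWeight φ t₁ t₂ w₁ w₂ = 0) ∨
      ∃ a, 0 ≤ a ∧ ∀ φ, quadWeight φ t₁ t₂ w₁ w₂ = φ a := by
  unfold quadWeight
  by_cases ht : 0 < t₁ ∧ t₁ < t₂ ∧ t₂ < 1
  swap
  · simp [ht]
  obtain ⟨h0, h1, h2⟩ := ht
  have ht : 0 < t₂ - t₁ := sub_pos.2 h1
  have ht2 : 0 < t₂ := h0.trans h1
  have ht1 : 0 < 1 - t₁ := by linarith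
  have hpos3 : t₁ * w₂ < t₂ * w₁ ∧ (1 - t₂) * w₁ < (1 - t₁) * w₂ → 0 < w₁ ∧ 0 < w₂ := by
    rintro ⟨g1, g2⟩
    have a1 : 0 < (t₂ - t₁) * w₁ := by nlinarith
    have a2 : 0 < (t₂ - t₁) * w₂ := by nlinarith
    exact ⟨(mul_pos_iff_of_pos_left ht).1 a1, (mul_pos_iff_of_pos_left ht).1 a2⟩
  have hpos4 : t₂ * w₁ < t₁ * w₂ ∧ (1 - t₁) * w₂ < (1 - t₂) * w₁ → w₁ < 0 ∧ w₂ < 0 := by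
    rintro ⟨g1, g2⟩
    have a1 : 0 < (t₂ - t₁) * (-w₁) := by nlinarith
    have a2 : 0 < (t₂ - t₁) * (-w₂) := by nlinarith
    exact ⟨by linarith [(mul_pos_iff_of_pos_left ht).1 a1],
      by linarith [(mul_pos_iff_of_pos_left ht).1 a2]⟩
  simp only [h0, h1, h2, and_self, if_true]
  by_cases r1 : 0 < w₁ ∧ w₂ < 0
  · have n2 : ¬ (w₁ < 0 ∧ 0 < w₂) := fun h => by linarith [h.1, r1.1]
    have n3 := mt hpos3 (fun h => by linarith [h.2, r1.2])
    have n4 := mt hpos4 (fun h => by linarith [h.1, r1.1])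
    refine Or.inr ⟨(w₁ - w₂) / 2, ?_, fun φ => by rw [if_pos r1, if_neg n2, if_neg n3, if_neg n4]; simp⟩
    linarith [r1.1, r1.2]
  by_cases r2 : w₁ < 0 ∧ 0 < w₂
  · have n3 := mt hpos3 (fun h => by linarith [h.1, r2.1])
    have n4 := mt hpos4 (fun h => by linarith [h.2, r2.2])
    refine Or.inr ⟨(w₂ - w₁) / 2, ?_, fun φ => by rw [if_neg r1, if_pos r2, if_neg n3, if_neg n4]; simp⟩
    linarith [r2.1, r2.2]
  by_cases r3 : t₁ * w₂ < t₂ * w₁ ∧ (1 - t₂) * w₁ < (1 - t₁) * w₂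
  · obtain ⟨g1, g2⟩ := hpos3 r3
    have n4 := mt hpos4 (fun h => by linarith [h.2, g2])
    refine Or.inr ⟨(t₂ * w₁ + (1 - t₁) * w₂) / 2, ?_, fun φ => by rw [if_neg r1, if_neg r2, if_pos r3, if_neg n4]; simp⟩
    positivity
  by_cases r4 : t₂ * w₁ < t₁ * w₂ ∧ (1 - t₁) * w₂ < (1 - t₂) * w₁
  · obtain ⟨g1, g2⟩ := hpos4 r4
    refine Or.inr ⟨-(t₂ * w₁ + (1 - t₁) * w₂) / 2, ?_, fun φ => by rw [if_neg r1, if_neg r2, if_neg r3, if_pos r4]; simp⟩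
    nlinarith
  exact Or.inl fun φ => by rw [if_neg r1, if_neg r2, if_neg r3, if_neg r4]; simp

theorem one_sub_ofReal_div_pow_le {n : ℕ} (hn : 8 ≤ n) (a : ℝ) :
    (1 - ENNReal.ofReal (a / n)) ^ (n - 4) ≤ ENNReal.ofReal (Real.exp (-(1 / 2 * a))) := by
  have hn' : (8 : ℝ) ≤ n := by exact_mod_cast hn
  rcases le_total 0 a with ha | ha
  · have hx : 0 ≤ a / n := by positivity
    calc (1 - ENNReal.ofReal (a / n)) ^ (n - 4)
        = ENNReal.ofReal (1 - a / n) ^ (n - 4) := by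
          rw [ENNReal.ofReal_sub _ hx, ENNReal.ofReal_one]
      _ ≤ ENNReal.ofReal (Real.exp (-(a / n))) ^ (n - 4) := by
          gcongr
          linarith [Real.add_one_le_exp (-(a / n))]
      _ = ENNReal.ofReal (Real.exp (((n - 4 : ℕ) : ℝ) * -(a / n))) := by
          rw [← ENNReal.ofReal_pow (Real.exp_pos _).le, Real.exp_nat_mul]
      _ ≤ _ := by
          gcongr
          rw [Nat.cast_sub (by omega)]
          have : ((4 : ℕ) : ℝ) = 4 := by norm_num
          rw [this, mul_neg, neg_le_neg_iff, mul_div_assoc', le_div_iff₀ (by linarith)]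
          nlinarith
  · have : ENNReal.ofReal (a / n) = 0 :=
      ENNReal.ofReal_of_nonpos (div_nonpos_of_nonpos_of_nonneg ha (by linarith))
    rw [this, tsub_zero, one_pow, ← ENNReal.ofReal_one]
    exact ENNReal.ofReal_le_ofReal (Real.one_le_exp (by linarith))

theorem tendsto_one_sub_ofReal_div_pow {a : ℝ} (ha : 0 ≤ a) :
    Tendsto (fun n : ℕ => (1 - ENNReal.ofReal (a / n)) ^ (n - 4)) atTop
      (nhds (ENNReal.ofReal (Real.exp (-a)))) := by
  have h1 : Tendsto (fun n : ℕ => (1 + -a / (n : ℝ)) ^ n) atTop (nhds (Real.exp (-a))) :=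
    Real.tendsto_one_add_div_pow_exp (-a)
  have h2 : Tendsto (fun n : ℕ => (1 + -a / (n : ℝ)) ^ 4) atTop (nhds ((1 + 0) ^ 4)) :=
    ((tendsto_const_div_atTop_nhds_zero_nat (-a)).const_add 1).pow 4
  have h3 := h1.div h2 (by norm_num)
  have h4 : Tendsto (fun n : ℕ => ENNReal.ofReal ((1 + -a / (n : ℝ)) ^ n / (1 + -a / (n : ℝ)) ^ 4))
      atTop (nhds (ENNReal.ofReal (Real.exp (-a)))) := by
    refine (ENNReal.continuous_ofReal.tendsto _).comp ?_
    simpa [Pi.div_def] using h3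
  refine h4.congr' ?_
  filter_upwards [eventually_ge_atTop 4, eventually_gt_atTop ⌈a⌉₊] with n hn hna
  have hna' : a < n := (Nat.le_ceil a).trans_lt (by exact_mod_cast hna)
  have hn0 : (0 : ℝ) < n := ha.trans_lt hna'
  have hx : 0 < 1 - a / n := by rw [sub_pos, div_lt_one hn0]; exact hna'
  have e : 1 + -a / (n : ℝ) = 1 - a / n := by ring
  rw [e, ← ENNReal.ofReal_one, ← ENNReal.ofReal_sub _ (by positivity), ← ENNReal.ofReal_pow hx.le]
  congr 1
  rw [div_eq_iff (by positivity), ← pow_add, Nat.sub_add_cancel hn]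

theorem quadFrame_eq_affine (p q : ℝ × ℝ) (N : ℝ) (z : ℝ × ℝ) :
    quadFrame p q N z = ((q.1 - p.1) * z.1 + 0 * z.2 + p.1,
      (q.2 - p.2) * z.1 + (N * (q.1 - p.1))⁻¹ * z.2 + p.2) := by
  simp only [quadFrame]
  ext
  · ring
  · simp only [div_eq_mul_inv]; ring

theorem measurable_quadFrame (p q : ℝ × ℝ) (N : ℝ) : Measurable (quadFrame p q N) := by
  unfold quadFrame
  fun_prop

theorem lintegral_comp_quadFrame {p q : ℝ × ℝ} {N : ℝ} (hpq : p.1 < q.1) (hN : 0 < N)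
    {f : ℝ × ℝ → ENNReal} (hf : Measurable f) :
    ∫⁻ z, f (quadFrame p q N z) = ENNReal.ofReal N * ∫⁻ z, f z := by
  have hL : q.1 - p.1 ≠ 0 := (sub_pos.2 hpq).ne'
  have hdet : (q.1 - p.1) * (N * (q.1 - p.1))⁻¹ - 0 * (q.2 - p.2) = N⁻¹ := by
    field_simp; simp
  simp_rw [quadFrame_eq_affine]
  rw [lintegral_comp_affine_plane (by rw [hdet]; positivity) _ _ hf, hdet, inv_inv, abs_of_pos hN]

theorem lintegral_prod_comp_quadFrame {p q : ℝ × ℝ} {N : ℝ} (hpq : p.1 < q.1) (hN : 0 < N)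
    {f : (ℝ × ℝ) × (ℝ × ℝ) → ENNReal} (hf : Measurable f) :
    ∫⁻ z : (ℝ × ℝ) × (ℝ × ℝ), f (quadFrame p q N z.1, quadFrame p q N z.2) =
      ENNReal.ofReal N ^ 2 * ∫⁻ z, f z := by
  have hq := measurable_quadFrame p q N
  rw [Measure.volume_eq_prod, lintegral_prod _ (by fun_prop), lintegral_prod _ hf.aemeasurable]
  have h1 : ∀ z : ℝ × ℝ, ∫⁻ z' : ℝ × ℝ, f (quadFrame p q N z, quadFrame p q N z') =
      ENNReal.ofReal N * (fun r => ∫⁻ s, f (r, s)) (quadFrame p q N z) := fun z =>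
    lintegral_comp_quadFrame hpq hN (f := fun s => f (quadFrame p q N z, s)) (by fun_prop)
  rw [lintegral_congr h1, lintegral_const_mul _ (by
    exact (hf.lintegral_prod_right').comp hq), lintegral_comp_quadFrame hpq hN hf.lintegral_prod_right']
  ring

theorem image_compl_singleton_eq_range {ι E : Type*} (y : ι → E) (i : ι) :
    y '' {i}ᶜ = Set.range fun j : {j // j ≠ i} => y j := by
  ext z; simp

section

variable {ι E : Type*} [Fintype ι] [NormedAddCommGroup E] [NormedSpace ℝ E]

theorem mem_convexHull_range_iff_exists_stdSimplex {y : ι → E} {z : E} :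
    z ∈ convexHull ℝ (Set.range y) ↔ ∃ w ∈ stdSimplex ℝ ι, ∑ i, w i • y i = z := by
  classical
  have h : Set.range y = Fintype.linearCombination ℝ y '' Set.range fun i => Pi.single i (1 : ℝ) := by
    rw [← Set.range_comp]
    congr 1
    ext i
    simp
  rw [h, ← LinearMap.image_convexHull, convexHull_rangle_single_eq_stdSimplex]
  simp [Fintype.linearCombination_apply]

theorem isClosed_setOf_mem_convexHull_range :
    IsClosed {z : (ι → E) × E | z.2 ∈ convexHull ℝ (Set.range z.1)} := by
  have h : IsClosed {z : stdSimplex ℝ ι × ((ι → E) × E) | ∑ i, z.1.1 i • z.2.1 i = z.2.2} :=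
    isClosed_eq (continuous_finsetSum _ fun i _ => by
      have : Continuous fun z : stdSimplex ℝ ι × ((ι → E) × E) => z.1.1 i :=
        (continuous_apply i).comp (continuous_subtype_val.comp continuous_fst)
      fun_prop) (by fun_prop)
  convert isClosedMap_snd_of_compactSpace _ h using 1
  ext z
  simp [mem_convexHull_range_iff_exists_stdSimplex]

variable [FiniteDimensional ℝ E] [MeasurableSpace E] [BorelSpace E]

theorem measurableSet_setOf_mem_convexHull_range :
    MeasurableSet {z : (ι → E) × E | z.2 ∈ convexHull ℝ (Set.range z.1)} :=
  isClosed_setOf_mem_convexHull_range.measurableSet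

theorem measurableSet_setOf_mem_interior_convexHull_range :
    MeasurableSet {z : (ι → E) × E | z.2 ∈ interior (convexHull ℝ (Set.range z.1))} := by
  have h : {z : (ι → E) × E | z.2 ∈ interior (convexHull ℝ (Set.range z.1))} =
      ⋃ k : ℕ, ⋂ u : Metric.ball (0 : E) (1 / (k + 1)),
        {z | z.2 + u.1 ∈ convexHull ℝ (Set.range z.1)} := by
    ext z
    simp only [Set.mem_iUnion, Set.mem_iInter, Set.mem_ofPred_eq, mem_interior_iff_mem_nhds,
      (Metric.nhds_basis_ball_inv_nat_succ (x := z.2)).mem_iff, true_and]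
    refine exists_congr fun k => ⟨fun hk u => hk (by simpa using u.2), fun hk x hx => ?_⟩
    simpa using hk ⟨x - z.2, by simpa [dist_eq_norm] using hx⟩
  rw [h]
  refine MeasurableSet.iUnion fun k => (isClosed_iInter fun u => ?_).measurableSet
  exact isClosed_setOf_mem_convexHull_range.preimage
    (f := fun z : (ι → E) × E => (z.1, z.2 + u.1)) (by fun_prop)

theorem measurableSet_convexFamily : MeasurableSet {y : ι → E | ConvexFamily y} := by
  classical
  have h : {y : ι → E | ConvexFamily y} = ⋂ i, {y : ι → E | ((fun j : {j // j ≠ i} => y j), y i) ∈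
      {z : ({j // j ≠ i} → E) × E | z.2 ∈ convexHull ℝ (Set.range z.1)}}ᶜ := by
    ext y
    simp [ConvexFamily, image_compl_singleton_eq_range]
  rw [h]
  refine MeasurableSet.iInter fun i => MeasurableSet.compl ?_
  exact (measurableSet_setOf_mem_convexHull_range (ι := {j // j ≠ i}) (E := E)).preimage
    (f := fun y : ι → E => ((fun j : {j // j ≠ i} => y j), y i)) (by fun_prop)

theorem measurable_measure_convexHull_range (μ : Measure E) [SFinite μ] :
    Measurable fun y : ι → E => μ (convexHull ℝ (Set.range y)) :=
  measurable_measure_prodMk_left measurableSet_setOf_mem_convexHull_range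

end

open Classical in
/-- The contribution of four points, sorted by `f` and in convex position, whose convex hull
has measure `v`, being `φ v`. -/
noncomputable def quadTerm {E : Type*} [AddCommGroup E] [Module ℝ E] [MeasurableSpace E]
    (f : E → ℝ) (μ : Measure E) (φ : ENNReal → ENNReal) (y : Fin 4 → E) : ENNReal :=
  if StrictMono (fun i => f (y i)) ∧ ConvexFamily y then φ (μ (convexHull ℝ (Set.range y))) else 0

theorem measurableSet_strictMono_comp {E : Type*} [MeasurableSpace E] {f : E → ℝ}
    (hf : Measurable f) {m : ℕ} : MeasurableSet {y : Fin m → E | StrictMono fun i => f (y i)} := by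
  have h : {y : Fin m → E | StrictMono fun i => f (y i)} =
      ⋂ (i : Fin m) (j : Fin m) (_ : i < j), {y | f (y i) < f (y j)} := by
    ext y; simp [StrictMono]
  rw [h]
  refine MeasurableSet.iInter fun i => MeasurableSet.iInter fun j => MeasurableSet.iInter fun _ => ?_
  exact measurableSet_lt (by fun_prop) (by fun_prop)

theorem measurable_quadTerm {E : Type*} [NormedAddCommGroup E] [NormedSpace ℝ E]
    [FiniteDimensional ℝ E] [MeasurableSpace E] [BorelSpace E] {f : E → ℝ} (hf : Measurable f)
    (μ : Measure E) [SFinite μ] {φ : ENNReal → ENNReal} (hφ : Measurable φ) :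
    Measurable (quadTerm f μ φ) := by
  classical
  unfold quadTerm
  exact Measurable.ite ((measurableSet_strictMono_comp hf).inter measurableSet_convexFamily)
    (hφ.comp (measurable_measure_convexHull_range μ)) measurable_const

theorem measurePreserving_four {E : Type*} [MeasurableSpace E] (μ : Measure E) [SigmaFinite μ] :
    MeasurePreserving (fun z : (E × E) × (E × E) => ![z.1.1, z.2.1, z.2.2, z.1.2])
      ((μ.prod μ).prod (μ.prod μ)) (Measure.pi fun _ => μ) := by
  have hm : Measurable fun z : (E × E) × (E × E) => ![z.1.1, z.2.1, z.2.2, z.1.2] := by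
    refine measurable_pi_lambda _ fun i => ?_
    fin_cases i <;> simp <;> fun_prop
  refine ⟨hm, (Measure.pi_eq fun s hs => ?_).symm⟩
  rw [Measure.map_apply hm (MeasurableSet.univ_pi hs)]
  have : (fun z : (E × E) × (E × E) => ![z.1.1, z.2.1, z.2.2, z.1.2]) ⁻¹' Set.univ.pi s =
      (s 0 ×ˢ s 3) ×ˢ (s 1 ×ˢ s 2) := by
    ext z
    simp [Fin.forall_fin_succ]
    tauto
  rw [this, Measure.prod_prod, Measure.prod_prod, Measure.prod_prod, Fin.prod_univ_four]
  ring

theorem strictMono_four_iff {E : Type*} (f : E → ℝ) (p r s q : E) :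
    (StrictMono fun i => f (![p, r, s, q] i)) ↔ f p < f r ∧ f r < f s ∧ f s < f q := by
  rw [Fin.strictMono_iff_lt_succ]
  simp [Fin.forall_fin_succ]

section

variable {K : Set (ℝ × ℝ)} {p q : ℝ × ℝ}

theorem quadTerm_quadFrame (hpq : p.1 < q.1) {N : ℝ} (hN : 0 < N) (φ : ENNReal → ENNReal)
    (z : (ℝ × ℝ) × (ℝ × ℝ)) :
    quadTerm Prod.fst volume φ ![p, quadFrame p q N z.1, quadFrame p q N z.2, q] =
      quadWeight (fun a => φ (ENNReal.ofReal (a / N))) z.1.1 z.2.1 z.1.2 z.2.2 := by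
  classical
  rw [← quadWeight_quadFrame hpq hN φ, quadTerm]
  exact if_congr (and_congr_left' (strictMono_four_iff Prod.fst _ _ _ _)) rfl rfl

theorem measurable_one_sub_pow (m : ℕ) : Measurable fun v : ENNReal => (1 - v) ^ m := by
  fun_prop

theorem measurable_quadTerm_pair {φ : ENNReal → ENNReal} (hφ : Measurable φ) (p q : ℝ × ℝ) :
    Measurable fun z : (ℝ × ℝ) × (ℝ × ℝ) =>
      quadTerm Prod.fst volume φ ![p, z.1, z.2, q] := by
  refine (measurable_quadTerm (E := ℝ × ℝ) measurable_fst volume hφ).comp (measurable_pi_lambda _ fun i => ?_)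
  fin_cases i <;> simp <;> fun_prop

theorem sq_mul_lintegral_quadTerm (hK : MeasurableSet K) (hpq : p.1 < q.1) {N : ℝ} (hN : 0 < N)
    {φ : ENNReal → ENNReal} (hφ : Measurable φ) :
    ENNReal.ofReal N ^ 2 * ∫⁻ z, quadTerm Prod.fst volume φ ![p, z.1, z.2, q]
      ∂((volume.restrict K).prod (volume.restrict K)) =
    ∫⁻ z : (ℝ × ℝ) × (ℝ × ℝ), {z | quadFrame p q N z.1 ∈ K ∧ quadFrame p q N z.2 ∈ K}.indicator
      (fun z => quadWeight (fun a => φ (ENNReal.ofReal (a / N))) z.1.1 z.2.1 z.1.2 z.2.2) z := by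
  have hm := (measurable_quadTerm_pair hφ p q).indicator (hK.prod hK)
  rw [Measure.prod_restrict, ← lintegral_indicator (hK.prod hK), ← Measure.volume_eq_prod,
    ← lintegral_prod_comp_quadFrame hpq hN hm]
  refine lintegral_congr fun z => ?_
  by_cases h : z ∈ {z : (ℝ × ℝ) × (ℝ × ℝ) | quadFrame p q N z.1 ∈ K ∧ quadFrame p q N z.2 ∈ K}
  · have h' : (quadFrame p q N z.1, quadFrame p q N z.2) ∈ K ×ˢ K := h
    rw [Set.indicator_of_mem h', Set.indicator_of_mem h, quadTerm_quadFrame hpq hN]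
  · have h' : (quadFrame p q N z.1, quadFrame p q N z.2) ∉ K ×ˢ K := h
    rw [Set.indicator_of_notMem h', Set.indicator_of_notMem h]

theorem quadWeight_mono {φ ψ : ℝ → ENNReal} (h : ∀ a, φ a ≤ ψ a) (t₁ t₂ w₁ w₂ : ℝ) :
    quadWeight φ t₁ t₂ w₁ w₂ ≤ quadWeight ψ t₁ t₂ w₁ w₂ := by
  rcases quadWeight_eq_zero_or_eq_apply t₁ t₂ w₁ w₂ with h0 | ⟨a, -, ha⟩
  · rw [h0]; exact zero_le
  · rw [ha, ha]; exact h a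

theorem indicator_quadWeight_le {n : ℕ} (hn : 8 ≤ n) (s : Set ((ℝ × ℝ) × (ℝ × ℝ)))
    (z : (ℝ × ℝ) × (ℝ × ℝ)) :
    s.indicator (fun z => quadWeight (fun a => (1 - ENNReal.ofReal (a / n)) ^ (n - 4))
      z.1.1 z.2.1 z.1.2 z.2.2) z ≤
    quadWeight (fun a => ENNReal.ofReal (Real.exp (-(1 / 2 * a)))) z.1.1 z.2.1 z.1.2 z.2.2 :=
  (Set.indicator_le_self _ _ z).trans (quadWeight_mono (one_sub_ofReal_div_pow_le hn) _ _ _ _)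

theorem sq_mul_lintegral_quadTerm_le (hK : MeasurableSet K) (hpq : p.1 < q.1) {n : ℕ}
    (hn : 8 ≤ n) :
    (n : ENNReal) ^ 2 * ∫⁻ z, quadTerm Prod.fst volume (fun v => (1 - v) ^ (n - 4))
      ![p, z.1, z.2, q] ∂((volume.restrict K).prod (volume.restrict K)) ≤
    ENNReal.ofReal (8 / (1 / 2) ^ 2) * ENNReal.ofReal (5 / 2 - Real.pi ^ 2 / 6) := by
  rw [← ENNReal.ofReal_natCast, sq_mul_lintegral_quadTerm hK hpq (by positivity)
    (measurable_one_sub_pow _), ← lintegral_quadWeight_exp_total (by norm_num)]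
  exact lintegral_mono fun z => indicator_quadWeight_le hn _ z

theorem tendsto_quadFrame (p q : ℝ × ℝ) (z : ℝ × ℝ) :
    Tendsto (fun n : ℕ => quadFrame p q n z) atTop (nhds (AffineMap.lineMap p q z.1)) := by
  have h1 : Tendsto (fun n : ℕ => z.2 / (n * (q.1 - p.1))) atTop (nhds 0) := by
    have := tendsto_const_div_atTop_nhds_zero_nat (z.2 / (q.1 - p.1))
    refine this.congr fun n => ?_
    rw [div_div, mul_comm]
  have h2 : AffineMap.lineMap p q z.1 =
      (p.1 + z.1 * (q.1 - p.1), p.2 + z.1 * (q.2 - p.2) + 0) := by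
    ext <;> simp [AffineMap.lineMap_apply] <;> ring
  rw [h2]
  exact tendsto_const_nhds.prodMk_nhds (tendsto_const_nhds.add h1)

theorem tendsto_indicator_quadWeight (hK : Convex ℝ K) (hp : p ∈ interior K)
    (hq : q ∈ interior K) (z : (ℝ × ℝ) × (ℝ × ℝ)) :
    Tendsto (fun n : ℕ =>
      {z | quadFrame p q n z.1 ∈ K ∧ quadFrame p q n z.2 ∈ K}.indicator
        (fun z => quadWeight (fun a => (1 - ENNReal.ofReal (a / n)) ^ (n - 4))
          z.1.1 z.2.1 z.1.2 z.2.2) z) atTop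
      (nhds (quadWeight (fun a => ENNReal.ofReal (Real.exp (-(1 * a))))
        z.1.1 z.2.1 z.1.2 z.2.2)) := by
  by_cases ht : 0 < z.1.1 ∧ z.1.1 < z.2.1 ∧ z.2.1 < 1
  · obtain ⟨h0, h1, h2⟩ := ht
    have hmem : ∀ x : ℝ × ℝ, 0 < x.1 → x.1 < 1 → ∀ᶠ n : ℕ in atTop, quadFrame p q n x ∈ K := by
      intro x hx0 hx1
      have hi : AffineMap.lineMap p q x.1 ∈ interior K :=
        hK.interior.lineMap_mem hp hq ⟨hx0.le, hx1.le⟩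
      exact ((tendsto_quadFrame p q x).eventually (isOpen_interior.mem_nhds hi)).mono
        fun n hn => interior_subset hn
    have hev : ∀ᶠ n : ℕ in atTop, quadWeight (fun a => (1 - ENNReal.ofReal (a / n)) ^ (n - 4))
          z.1.1 z.2.1 z.1.2 z.2.2 =
        {z | quadFrame p q n z.1 ∈ K ∧ quadFrame p q n z.2 ∈ K}.indicator
        (fun z => quadWeight (fun a => (1 - ENNReal.ofReal (a / n)) ^ (n - 4))
          z.1.1 z.2.1 z.1.2 z.2.2) z := by
      filter_upwards [hmem z.1 h0 (h1.trans h2), hmem z.2 (h0.trans h1) h2] with n g1 g2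
      rw [Set.indicator_of_mem (show z ∈ {z | quadFrame p q n z.1 ∈ K ∧ quadFrame p q n z.2 ∈ K}
        from ⟨g1, g2⟩)]
    refine Tendsto.congr' hev ?_
    rcases quadWeight_eq_zero_or_eq_apply z.1.1 z.2.1 z.1.2 z.2.2 with h | ⟨a, ha0, ha⟩
    · simp only [h]; exact tendsto_const_nhds
    · simp only [ha, one_mul]
      exact tendsto_one_sub_ofReal_div_pow ha0
  · have h : ∀ φ (z : (ℝ × ℝ) × (ℝ × ℝ)), ¬ (0 < z.1.1 ∧ z.1.1 < z.2.1 ∧ z.2.1 < 1) →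
        quadWeight φ z.1.1 z.2.1 z.1.2 z.2.2 = 0 := fun φ z hz => if_neg hz
    rw [h _ z ht]
    refine tendsto_const_nhds.congr fun n => ?_
    refine (le_antisymm ((Set.indicator_le_self _ _ z).trans (h _ z ht).le) zero_le).symm

theorem tendsto_sq_mul_lintegral_quadTerm (hK : Convex ℝ K) (hKm : MeasurableSet K)
    (hpq : p.1 < q.1) (hp : p ∈ interior K) (hq : q ∈ interior K) :
    Tendsto (fun n : ℕ => (n : ENNReal) ^ 2 * ∫⁻ z, quadTerm Prod.fst volume
      (fun v => (1 - v) ^ (n - 4)) ![p, z.1, z.2, q]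
        ∂((volume.restrict K).prod (volume.restrict K))) atTop
      (nhds (ENNReal.ofReal (8 / 1 ^ 2) * ENNReal.ofReal (5 / 2 - Real.pi ^ 2 / 6))) := by
  rw [← lintegral_quadWeight_exp_total one_pos]
  have hlim := tendsto_lintegral_filter_of_dominated_convergence (μ := volume) (l := atTop)
    (F := fun n : ℕ => fun z => {z | quadFrame p q n z.1 ∈ K ∧ quadFrame p q n z.2 ∈ K}.indicator
        (fun z => quadWeight (fun a => (1 - ENNReal.ofReal (a / n)) ^ (n - 4))
          z.1.1 z.2.1 z.1.2 z.2.2) z)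
    (f := fun z => quadWeight (fun a => ENNReal.ofReal (Real.exp (-(1 * a))))
        z.1.1 z.2.1 z.1.2 z.2.2)
    (fun z : (ℝ × ℝ) × (ℝ × ℝ) => quadWeight (fun a => ENNReal.ofReal (Real.exp (-(1 / 2 * a))))
      z.1.1 z.2.1 z.1.2 z.2.2) ?_ ?_ ?_ ?_
  · refine hlim.congr' ?_
    filter_upwards [eventually_gt_atTop 0] with n hn
    rw [← ENNReal.ofReal_natCast, sq_mul_lintegral_quadTerm hKm hpq (by exact_mod_cast hn)
      (measurable_one_sub_pow _)]
  · refine Eventually.of_forall fun n => Measurable.indicator ?_ ?_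
    · exact (measurable_quadWeight (φ := fun a => (1 - ENNReal.ofReal (a / n)) ^ (n - 4))
        (by fun_prop)).comp (g := _) (f := fun z : (ℝ × ℝ) × (ℝ × ℝ) =>
          ((z.1.1, z.2.1), (z.1.2, z.2.2))) (by fun_prop)
    · have hm := measurable_quadFrame p q n
      exact (hKm.preimage (hm.comp measurable_fst)).inter (hKm.preimage (hm.comp measurable_snd))
  · filter_upwards [eventually_ge_atTop 8] with n hn
    exact Eventually.of_forall fun z => indicator_quadWeight_le hn _ z
  · rw [lintegral_quadWeight_exp_total (by norm_num)]
    exact ENNReal.mul_ne_top ENNReal.ofReal_ne_top ENNReal.ofReal_ne_top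
  · exact Eventually.of_forall fun z => tendsto_indicator_quadWeight hK hp hq z

end

theorem volume_setOf_fst_eq (a : ℝ) : volume {z : ℝ × ℝ | a = z.1} = 0 := by
  have : {z : ℝ × ℝ | a = z.1} = {a} ×ˢ Set.univ := by ext z; simp [eq_comm]
  rw [this, Measure.volume_eq_prod, Measure.prod_prod]
  simp

theorem prod_setOf_fst_lt (μ : Measure (ℝ × ℝ)) [IsProbabilityMeasure μ] (hμ : μ ≪ volume) :
    (μ.prod μ) {z | z.1.1 < z.2.1} = 2⁻¹ := by
  have hA : MeasurableSet {z : (ℝ × ℝ) × (ℝ × ℝ) | z.1.1 < z.2.1} :=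
    measurableSet_lt (by fun_prop) (by fun_prop)
  have hB : MeasurableSet {z : (ℝ × ℝ) × (ℝ × ℝ) | z.2.1 < z.1.1} :=
    measurableSet_lt (by fun_prop) (by fun_prop)
  have hswap : (μ.prod μ) {z | z.2.1 < z.1.1} = (μ.prod μ) {z | z.1.1 < z.2.1} := by
    conv_lhs => rw [← Measure.prod_swap, Measure.map_apply measurable_swap hB]
    rfl
  have hnull : (μ.prod μ) {z | z.1.1 = z.2.1} = 0 := by
    rw [Measure.measure_prod_null (measurableSet_eq_fun (by fun_prop) (by fun_prop))]
    exact Eventually.of_forall fun p => hμ (volume_setOf_fst_eq p.1)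
  have hunion : (μ.prod μ) ({z | z.1.1 < z.2.1} ∪ {z | z.2.1 < z.1.1}) = 1 := by
    rw [← prob_compl_eq_zero_iff (hA.union hB)]
    refine measure_mono_null (fun z hz => ?_) hnull
    simp only [Set.mem_compl_iff, Set.mem_union, Set.mem_ofPred_eq, not_or, not_lt] at hz ⊢
    exact le_antisymm hz.2 hz.1
  have hdisj : Disjoint {z : (ℝ × ℝ) × (ℝ × ℝ) | z.1.1 < z.2.1} {z | z.2.1 < z.1.1} :=
    Set.disjoint_left.2 fun z (h1 : z.1.1 < z.2.1) (h2 : z.2.1 < z.1.1) => lt_asymm h1 h2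
  rw [measure_union hdisj hB, hswap, ← two_mul] at hunion
  exact ENNReal.eq_inv_of_mul_eq_one_left (by rwa [mul_comm])

theorem tendsto_sq_mul_lintegral_pi_quadTerm {K : Set (ℝ × ℝ)} (hK : Convex ℝ K)
    (hKm : MeasurableSet K) (hvol : volume K = 1) :
    Tendsto (fun n : ℕ => (n : ENNReal) ^ 2 * ∫⁻ y, quadTerm Prod.fst volume
      (fun v => (1 - v) ^ (n - 4)) y ∂(Measure.pi fun _ => volume.restrict K)) atTop
      (nhds (ENNReal.ofReal (10 - 2 * Real.pi ^ 2 / 3))) := by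
  set μ : Measure (ℝ × ℝ) := volume.restrict K with hμ
  have hprob : IsProbabilityMeasure μ := ⟨by rw [hμ, Measure.restrict_apply_univ, hvol]⟩
  set c := ENNReal.ofReal (8 / 1 ^ 2) * ENNReal.ofReal (5 / 2 - Real.pi ^ 2 / 6) with hc
  have hqm : ∀ n : ℕ, Measurable fun z : ((ℝ × ℝ) × (ℝ × ℝ)) × ((ℝ × ℝ) × (ℝ × ℝ)) =>
      quadTerm Prod.fst volume (fun v => (1 - v) ^ (n - 4)) ![z.1.1, z.2.1, z.2.2, z.1.2] :=
    fun n => (measurable_quadTerm (E := ℝ × ℝ) measurable_fst volume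
      (measurable_one_sub_pow _)).comp (measurePreserving_four μ).measurable
  have hA : MeasurableSet {z : (ℝ × ℝ) × (ℝ × ℝ) | z.1.1 < z.2.1} :=
    measurableSet_lt (by fun_prop) (by fun_prop)
  have hlim : ENNReal.ofReal (10 - 2 * Real.pi ^ 2 / 3) =
      ∫⁻ z, {z : (ℝ × ℝ) × (ℝ × ℝ) | z.1.1 < z.2.1}.indicator (fun _ => c) z ∂(μ.prod μ) := by
    rw [lintegral_indicator_const hA, prod_setOf_fst_lt μ Measure.restrict_le_self.absolutelyContinuous,
      hc, ← ENNReal.ofReal_mul (by norm_num), ← ENNReal.ofReal_ofNat 2,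
      ← ENNReal.ofReal_inv_of_pos (by norm_num), ← ENNReal.ofReal_mul' (by norm_num)]
    congr 1
    ring
  have hint : ∀ n : ℕ, (n : ENNReal) ^ 2 * ∫⁻ y, quadTerm Prod.fst volume
      (fun v => (1 - v) ^ (n - 4)) y ∂(Measure.pi fun _ => μ) =
      ∫⁻ w, (n : ENNReal) ^ 2 * ∫⁻ z, quadTerm Prod.fst volume
        (fun v => (1 - v) ^ (n - 4)) ![w.1, z.1, z.2, w.2] ∂(μ.prod μ) ∂(μ.prod μ) := by
    intro n
    rw [← (measurePreserving_four μ).lintegral_comp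
      (measurable_quadTerm (E := ℝ × ℝ) measurable_fst volume (measurable_one_sub_pow _)),
      lintegral_prod _ (hqm n).aemeasurable, lintegral_const_mul _ (hqm n).lintegral_prod_right']
  rw [hlim]
  simp_rw [hint]
  have hzero : ∀ w : (ℝ × ℝ) × (ℝ × ℝ), ¬ w.1.1 < w.2.1 → ∀ n : ℕ,
      (n : ENNReal) ^ 2 * ∫⁻ z, quadTerm Prod.fst volume
        (fun v => (1 - v) ^ (n - 4)) ![w.1, z.1, z.2, w.2] ∂(μ.prod μ) = 0 := by
    intro w hw n
    have : ∀ z : (ℝ × ℝ) × (ℝ × ℝ), quadTerm Prod.fst volume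
        (fun v => (1 - v) ^ (n - 4)) ![w.1, z.1, z.2, w.2] = 0 := fun z => by
      refine if_neg fun h => hw ?_
      have := (strictMono_four_iff Prod.fst _ _ _ _).1 h.1
      exact this.1.trans (this.2.1.trans this.2.2)
    simp [this]
  refine tendsto_lintegral_filter_of_dominated_convergence
    (fun _ => ENNReal.ofReal (8 / (1 / 2) ^ 2) * ENNReal.ofReal (5 / 2 - Real.pi ^ 2 / 6))
    (Eventually.of_forall fun n => (hqm n).lintegral_prod_right'.const_mul _) ?_ ?_ ?_
  · filter_upwards [eventually_ge_atTop 8] with n hn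
    refine Eventually.of_forall fun w => ?_
    by_cases hw : w.1.1 < w.2.1
    · exact sq_mul_lintegral_quadTerm_le hKm hw hn
    · rw [hzero w hw]; exact zero_le
  · rw [lintegral_const]
    exact ENNReal.mul_ne_top (ENNReal.mul_ne_top ENNReal.ofReal_ne_top ENNReal.ofReal_ne_top)
      (measure_ne_top _ _)
  · have hae : ∀ᵐ x ∂μ, x ∈ interior K := by
      have h1 : ∀ᵐ x ∂μ, x ∈ K := ae_restrict_mem hKm
      have h2 : ∀ᵐ x ∂μ, x ∉ frontier K :=
        ae_restrict_of_ae (measure_eq_zero_iff_ae_notMem.1 (hK.addHaar_frontier volume))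
      filter_upwards [h1, h2] with x hx1 hx2
      by_contra hx
      exact hx2 ⟨subset_closure hx1, hx⟩
    have h1 : ∀ᵐ w ∂(μ.prod μ), w.1 ∈ interior K := Measure.quasiMeasurePreserving_fst.ae hae
    have h2 : ∀ᵐ w ∂(μ.prod μ), w.2 ∈ interior K := Measure.quasiMeasurePreserving_snd.ae hae
    filter_upwards [h1, h2] with w hw1 hw2
    by_cases hw : w ∈ {w : (ℝ × ℝ) × (ℝ × ℝ) | w.1.1 < w.2.1}
    · rw [Set.indicator_of_mem hw]
      exact tendsto_sq_mul_lintegral_quadTerm hK hKm hw hw1 hw2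
    · rw [Set.indicator_of_notMem hw]
      simp_rw [hzero w hw]
      exact tendsto_const_nhds

section

variable {E F : Type*} [NormedAddCommGroup E] [NormedSpace ℝ E] [NormedAddCommGroup F]
  [NormedSpace ℝ F]

theorem convexFamily_comp_linearEquiv {ι : Type*} (L : E ≃L[ℝ] F) (y : ι → E) :
    ConvexFamily (fun i => L (y i)) ↔ ConvexFamily y := by
  refine forall_congr' fun i => not_congr ?_
  have h : (fun i => L (y i)) '' {i}ᶜ = (L : E →ₗ[ℝ] F) '' (y '' {i}ᶜ) := by
    rw [Set.image_image]; rfl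
  rw [h, ← LinearMap.image_convexHull]
  exact L.injective.mem_set_image

variable [MeasurableSpace E] [BorelSpace E] [MeasurableSpace F] [BorelSpace F]

theorem quadTerm_comp_linearEquiv (L : E ≃L[ℝ] F) {μ : Measure E} {ν : Measure F}
    (hL : MeasurePreserving L μ ν) (f : F → ℝ) (φ : ENNReal → ENNReal) (y : Fin 4 → E) :
    quadTerm f ν φ (fun i => L (y i)) = quadTerm (fun x => f (L x)) μ φ y := by
  classical
  have hv : ν (convexHull ℝ (Set.range fun i => L (y i))) = μ (convexHull ℝ (Set.range y)) := by
    have h : (Set.range fun i => L (y i)) = (L : E →ₗ[ℝ] F) '' Set.range y := by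
      rw [← Set.range_comp]; rfl
    rw [h, ← LinearMap.image_convexHull,
      ← hL.measure_preimage_emb L.toHomeomorph.measurableEmbedding]
    congr 1
    exact Set.preimage_image_eq _ L.injective
  unfold quadTerm
  rw [hv]
  exact if_congr (and_congr_right' (convexFamily_comp_linearEquiv L y)) rfl rfl

end

theorem tendsto_sq_mul_lintegral_quadTerm_euclidean {K : Set (EuclideanSpace ℝ (Fin 2))}
    (hK : Convex ℝ K) (hKm : MeasurableSet K) (hvol : volume K = 1) :
    Tendsto (fun n : ℕ => (n : ENNReal) ^ 2 * ∫⁻ y, quadTerm (fun x => x 0) volume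
      (fun v => (1 - v) ^ (n - 4)) y ∂(Measure.pi fun _ => volume.restrict K)) atTop
      (nhds (ENNReal.ofReal (10 - 2 * Real.pi ^ 2 / 3))) := by
  set L : EuclideanSpace ℝ (Fin 2) ≃L[ℝ] ℝ × ℝ :=
    (PiLp.continuousLinearEquiv 2 ℝ (fun _ : Fin 2 => ℝ)).trans
      (ContinuousLinearEquiv.finTwoArrow ℝ ℝ) with hL
  have hLp : MeasurePreserving L volume volume :=
    (volume_preserving_finTwoArrow ℝ).comp (PiLp.volume_preserving_ofLp (Fin 2))
  have hLe : MeasurableEmbedding L := L.toHomeomorph.measurableEmbedding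
  have hK' : L ⁻¹' (L.symm ⁻¹' K) = K := by ext x; simp
  have hKm' : MeasurableSet (L.symm ⁻¹' K) := hKm.preimage L.symm.continuous.measurable
  have h := tendsto_sq_mul_lintegral_pi_quadTerm (K := L.symm ⁻¹' K)
    (hK.linear_preimage (L.symm : ℝ × ℝ →ₗ[ℝ] _)) hKm'
    (by rw [← hLp.measure_preimage_emb hLe, hK', hvol])
  have hr : MeasurePreserving L (volume.restrict K) (volume.restrict (L.symm ⁻¹' K)) := by
    have := hLp.restrict_preimage_emb hLe (L.symm ⁻¹' K)
    rwa [hK'] at this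
  have hfin : IsFiniteMeasure (volume.restrict K) := ⟨by simp [hvol]⟩
  have hfin : IsFiniteMeasure (volume.restrict (L.symm ⁻¹' K)) :=
    ⟨by rw [← hr.measure_preimage_emb hLe]; exact measure_lt_top _ _⟩
  refine h.congr fun n => ?_
  congr 1
  rw [← (measurePreserving_pi (fun _ : Fin 4 => volume.restrict K)
    (fun _ : Fin 4 => volume.restrict (L.symm ⁻¹' K)) fun _ => hr).lintegral_comp
      (measurable_quadTerm (E := ℝ × ℝ) measurable_fst volume (measurable_one_sub_pow _))]
  exact lintegral_congr fun y => quadTerm_comp_linearEquiv L hLp _ _ y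

theorem ConvexFamily.notMem_interior_convexHull {ι E : Type*} [Nontrivial ι] [NormedAddCommGroup E]
    [NormedSpace ℝ E] {y : ι → E} (hy : ConvexFamily y) (i : ι) :
    y i ∉ interior (convexHull ℝ (Set.range y)) := by
  intro hi
  obtain ⟨j, hj⟩ := exists_ne i
  have hjS : y j ∈ y '' {i}ᶜ := ⟨j, hj, rfl⟩
  have hrange : Set.range y = insert (y i) (y '' {i}ᶜ) := by
    rw [← Set.image_insert_eq, Set.insert_eq, Set.union_compl_self, Set.image_univ]
  rw [hrange, convexHull_insert ⟨_, hjS⟩] at hi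
  have hcont : Tendsto (fun t : ℝ => y i + t • (y i - y j)) (nhds 0) (nhds (y i)) := by
    have : Continuous fun t : ℝ => y i + t • (y i - y j) := by fun_prop
    simpa using this.tendsto 0
  obtain ⟨t, ht, ht0⟩ := ((hcont.eventually (mem_interior_iff_mem_nhds.1 hi)).filter_mono
    nhdsWithin_le_nhds |>.and (self_mem_nhdsWithin (a := (0 : ℝ)) (s := Set.Ioi 0))).exists
  obtain ⟨_, rfl, b, hb, a₁, a₂, h1, h2, h12, hab⟩ := mem_convexJoin.1 ht
  have hne : t + a₂ ≠ 0 := by positivity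
  refine hy i ?_
  have key : y i = (t / (t + a₂)) • y j + (a₂ / (t + a₂)) • b := by
    have e1 : (t + a₂) • y i = t • y j + a₂ • b := by
      have h1' : a₁ = 1 - a₂ := by linarith
      rw [eq_sub_of_add_eq' hab, h1']
      module
    rw [div_eq_inv_mul, div_eq_inv_mul, mul_smul, mul_smul, ← smul_add, ← e1, inv_smul_smul₀ hne]
  rw [key]
  exact (convex_convexHull ℝ _) (subset_convexHull ℝ _ hjS) hb (by positivity) (by positivity)
    (by field_simp)

theorem inConvexPosition_range_iff {ι : Type*} {d : ℕ} {y : ι → Euc d} (hy : Function.Injective y) :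
    InConvexPosition (Set.range y) ↔ ConvexFamily y := by
  simp only [InConvexPosition, Set.forall_mem_range, ConvexFamily]
  refine forall_congr' fun i => ?_
  rw [Set.image_compl_eq_range_sdiff_image hy, Set.image_singleton]

/-- The embedding `e` selects, in increasing order of first coordinates, the vertices of a hole. -/
def SortedHole {n : ℕ} (x : Fin n → Euc 2) (e : Fin 4 ↪ Fin n) : Prop :=
  (StrictMono (fun i => x (e i) 0) ∧ ConvexFamily (fun i => x (e i))) ∧
    ∀ j ∉ Set.range e, x j ∉ interior (convexHull ℝ (Set.range fun i => x (e i)))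

open Classical in
theorem holeCount_eq_card_sortedHole {n : ℕ} {x : Fin n → Euc 2}
    (hx : Function.Injective fun i => x i 0) :
    holeCount 2 4 n x = (Finset.univ.filter (SortedHole x)).card := by
  have hxi : Function.Injective x := fun i j h => hx (by simp [h])
  have hcoe : ∀ e : Fin 4 ↪ Fin n, ((Finset.univ.image fun i => x (e i) : Finset (Euc 2)) :
      Set (Euc 2)) = Set.range fun i => x (e i) := by intro e; simp
  unfold holeCount
  symm
  refine Finset.card_bij (fun e _ => Finset.univ.image fun i => x (e i)) ?_ ?_ ?_
  · intro e he
    obtain ⟨⟨hs, hc⟩, hempty⟩ := (Finset.mem_filter.1 he).2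
    have hsub : (Finset.univ.image fun i => x (e i)) ⊆ Finset.image x Finset.univ := by
      intro p hp
      simp only [Finset.mem_image, Finset.mem_univ, true_and] at hp ⊢
      obtain ⟨i, rfl⟩ := hp
      exact ⟨_, rfl⟩
    rw [Finset.mem_filter, Finset.mem_powerset]
    refine ⟨hsub, hsub, ?_, ?_, ?_⟩
    · exact (Finset.card_image_of_injective _ (hxi.comp e.injective)).trans (by simp)
    · rw [hcoe]
      exact (inConvexPosition_range_iff (hxi.comp e.injective)).2 hc
    · intro p hp
      rw [hcoe]
      simp only [Finset.mem_image, Finset.mem_univ, true_and] at hp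
      obtain ⟨j, rfl⟩ := hp
      by_cases hj : j ∈ Set.range e
      · obtain ⟨i, rfl⟩ := hj
        exact hc.notMem_interior_convexHull i
      · exact hempty j hj
  · intro e he e' he' heq
    have h1 := (Finset.mem_filter.1 he).2.1.1
    have h2 := (Finset.mem_filter.1 he').2.1.1
    have hr : (Set.range fun i => x (e i)) = Set.range fun i => x (e' i) := by
      rw [← hcoe, ← hcoe]; exact congrArg _ heq
    have hr' : (Set.range fun i => x (e i) 0) = Set.range fun i => x (e' i) 0 := by
      have := congrArg (fun s => (fun p : Euc 2 => p 0) '' s) hr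
      simpa only [← Set.range_comp, Function.comp_def] using this
    have hfun := (h1.range_inj h2).1 hr'
    ext i
    exact congrArg _ (hx (congrFun hfun i))
  · intro H hH
    obtain ⟨hsub, -, hcard, hconv, hempty⟩ := (Finset.mem_filter.1 hH).imp Finset.mem_powerset.1 id
    have hinj : Set.InjOn (fun p : Euc 2 => p 0) H := by
      intro p hp q hq hpq
      obtain ⟨i, -, rfl⟩ := Finset.mem_image.1 (hsub hp)
      obtain ⟨j, -, rfl⟩ := Finset.mem_image.1 (hsub hq)
      exact congrArg x (hx hpq)
    have hT : (H.image fun p : Euc 2 => p 0).card = 4 := by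
      rw [Finset.card_image_of_injOn hinj, hcard]
    set g := (H.image fun p : Euc 2 => p 0).orderEmbOfFin hT with hg
    have hex : ∀ i, ∃ j, x j ∈ H ∧ x j 0 = g i := by
      intro i
      obtain ⟨p, hp, hpe⟩ := Finset.mem_image.1 (Finset.orderEmbOfFin_mem _ hT i)
      obtain ⟨j, -, rfl⟩ := Finset.mem_image.1 (hsub hp)
      exact ⟨j, hp, hpe⟩
    choose e heH heg using hex
    have hei : Function.Injective e := fun i j h => g.injective (by rw [← heg, ← heg, h])
    have himg : (Finset.univ.image fun i => x (e i)) = H := by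
      refine Finset.eq_of_subset_of_card_le ?_ ?_
      · intro p hp
        obtain ⟨i, -, rfl⟩ := Finset.mem_image.1 hp
        exact heH i
      · rw [hcard]
        exact ((Finset.card_image_of_injective _ (hxi.comp hei)).trans (by simp)).ge
    have hcoe' : (H : Set (Euc 2)) = Set.range fun i => x (e i) := by
      rw [← himg]; exact hcoe ⟨e, hei⟩
    rw [hcoe'] at hconv hempty
    refine ⟨⟨e, hei⟩, Finset.mem_filter.2 ⟨Finset.mem_univ _, ⟨?_, ?_⟩, ?_⟩, himg⟩
    · simp only [Function.Embedding.coeFn_mk, heg]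
      exact g.strictMono
    · exact (inConvexPosition_range_iff (hxi.comp hei)).1 hconv
    · intro j _
      exact hempty _ (Finset.mem_image_of_mem _ (Finset.mem_univ _))

theorem ae_injective_apply_zero (K : Set (Euc 2)) (n : ℕ) :
    ∀ᵐ x ∂(Measure.pi fun _ : Fin n => (volume : Measure (Euc 2)).restrict K),
      Function.Injective fun i => x i 0 := by
  rw [← Measure.restrict_pi_pi (fun _ : Fin n => (volume : Measure (Euc 2))) fun _ => K]
  refine ae_restrict_of_ae ?_
  have h : ∀ i j : Fin n, i ≠ j → ∀ᵐ x ∂(Measure.pi fun _ : Fin n => (volume : Measure (Euc 2))),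
      x i 0 ≠ x j 0 := by
    intro i j hij
    let s : Submodule ℝ (Fin n → Euc 2) :=
      { carrier := {x | x i 0 = x j 0}
        add_mem' := fun {x y} (hx : x i 0 = x j 0) (hy : y i 0 = y j 0) =>
          show (x + y) i 0 = (x + y) j 0 by simp [hx, hy]
        zero_mem' := rfl
        smul_mem' := fun c x (hx : x i 0 = x j 0) =>
          show (c • x) i 0 = (c • x) j 0 by simp [hx] }
    have hs : s ≠ ⊤ := by
      intro htop
      have hmem : Pi.single i (EuclideanSpace.single 0 (1 : ℝ)) ∈ s := htop ▸ Submodule.mem_top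
      have hval : (Pi.single i (EuclideanSpace.single 0 (1 : ℝ)) : Fin n → Euc 2) i 0 =
        (Pi.single i (EuclideanSpace.single 0 (1 : ℝ)) : Fin n → Euc 2) j 0 := hmem
      simp [Pi.single_eq_of_ne hij.symm] at hval
    exact measure_eq_zero_iff_ae_notMem.1 (Measure.addHaar_submodule _ s hs)
  have h' := ae_all_iff.2 fun i => ae_all_iff.2 fun j => (ae_all_iff.2 (h i j))
  filter_upwards [h'] with x hx i j hij
  by_contra hne
  exact hx i j hne hij

theorem measurableSet_sortedHole {n : ℕ} (e : Fin 4 ↪ Fin n) :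
    MeasurableSet {x : Fin n → Euc 2 | SortedHole x e} := by
  have hsel : Measurable fun x : Fin n → Euc 2 => fun i => x (e i) := by fun_prop
  have h1 : MeasurableSet {x : Fin n → Euc 2 | StrictMono fun i => x (e i) 0} :=
    (measurableSet_strictMono_comp (f := fun p : Euc 2 => p 0) (by fun_prop)).preimage hsel
  have h2 : MeasurableSet {x : Fin n → Euc 2 | ConvexFamily fun i => x (e i)} :=
    measurableSet_convexFamily.preimage hsel
  have h3 : MeasurableSet {x : Fin n → Euc 2 | ∀ j ∉ Set.range e,
      x j ∉ interior (convexHull ℝ (Set.range fun i => x (e i)))} := by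
    have h : {x : Fin n → Euc 2 | ∀ j ∉ Set.range e,
        x j ∉ interior (convexHull ℝ (Set.range fun i => x (e i)))} =
        ⋂ (j : Fin n) (_ : j ∉ Set.range e),
          {x | x j ∈ interior (convexHull ℝ (Set.range fun i => x (e i)))}ᶜ := by
      ext x; simp
    rw [h]
    refine MeasurableSet.iInter fun j => MeasurableSet.iInter fun _ => MeasurableSet.compl ?_
    exact measurableSet_setOf_mem_interior_convexHull_range.preimage
      (f := fun x : Fin n → Euc 2 => ((fun i => x (e i)), x j)) (by fun_prop)
  exact (h1.inter h2).inter h3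

/-- Independent points can be split along an embedding of the index type. -/
theorem exists_measurePreserving_split {E : Type*} [MeasurableSpace E] (μ : Measure E)
    [SigmaFinite μ] {m n : ℕ} (e : Fin m ↪ Fin n) :
    ∃ Ψ : (Fin m → E) × ({j // j ∉ Set.range e} → E) → (Fin n → E),
      MeasurePreserving Ψ ((Measure.pi fun _ => μ).prod (Measure.pi fun _ => μ))
        (Measure.pi fun _ => μ) ∧
      (∀ z i, Ψ z (e i) = z.1 i) ∧ ∀ z (j : {j // j ∉ Set.range e}), Ψ z j = z.2 j := by
  classical
  let σ : Fin m ⊕ {j // j ∉ Set.range e} ≃ Fin n :=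
    ((Equiv.ofInjective e e.injective).sumCongr (Equiv.refl _)).trans
      (Equiv.sumCompl fun j => j ∈ Set.range e)
  have h1 := measurePreserving_sumPiEquivProdPi_symm
    (fun _ : Fin m ⊕ {j // j ∉ Set.range e} => μ)
  have h2 := measurePreserving_piCongrLeft (fun _ : Fin n => μ) σ
  refine ⟨_, h2.comp h1, fun z i => ?_, fun z j => ?_⟩
  · have := Equiv.piCongrLeft_apply_apply (fun _ : Fin n => E) σ
      ((MeasurableEquiv.sumPiEquivProdPi fun _ => E).symm z) (Sum.inl i)
    exact this
  · have := Equiv.piCongrLeft_apply_apply (fun _ : Fin n => E) σ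
      ((MeasurableEquiv.sumPiEquivProdPi fun _ => E).symm z) (Sum.inr j)
    exact this

theorem measure_sortedHole {K : Set (Euc 2)} (hK : Convex ℝ K) (hKm : MeasurableSet K)
    (hvol : volume K = 1) {n : ℕ} (e : Fin 4 ↪ Fin n) :
    (Measure.pi fun _ : Fin n => (volume : Measure (Euc 2)).restrict K) {x | SortedHole x e} =
      ∫⁻ y, quadTerm (fun x : Euc 2 => x 0) volume (fun v => (1 - v) ^ (n - 4)) y
        ∂(Measure.pi fun _ => volume.restrict K) := by
  set μ : Measure (Euc 2) := volume.restrict K with hμ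
  have hprob : IsProbabilityMeasure μ := ⟨by rw [hμ, Measure.restrict_apply_univ, hvol]⟩
  obtain ⟨Ψ, hΨ, hΨ1, hΨ2⟩ := exists_measurePreserving_split μ e
  rw [← hΨ.measure_preimage (measurableSet_sortedHole e).nullMeasurableSet,
    Measure.prod_apply ((measurableSet_sortedHole e).preimage hΨ.measurable)]
  have hyK : ∀ᵐ y ∂(Measure.pi fun _ : Fin 4 => μ), ∀ i, y i ∈ K := ae_all_iff.2 fun i =>
    (Measure.quasiMeasurePreserving_eval (fun _ : Fin 4 => μ) i).ae (ae_restrict_mem hKm)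
  refine lintegral_congr_ae ?_
  filter_upwards [hyK] with y hy
  have hsub : convexHull ℝ (Set.range y) ⊆ K := convexHull_min (Set.range_subset_iff.2 hy) hK
  have hint : MeasurableSet (interior (convexHull ℝ (Set.range y))) := isOpen_interior.measurableSet
  have hμint : μ (interior (convexHull ℝ (Set.range y))) = volume (convexHull ℝ (Set.range y)) := by
    rw [hμ, Measure.restrict_apply hint, Set.inter_eq_left.2 (interior_subset.trans hsub)]
    exact measure_congr (interior_ae_eq_of_null_frontier
      ((convex_convexHull ℝ _).addHaar_frontier volume))
  have hcard : Fintype.card {j // j ∉ Set.range e} = n - 4 := by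
    rw [Fintype.card_subtype_compl, Fintype.card_fin]
    congr 1
    exact (Fintype.card_congr (Equiv.ofInjective e e.injective).symm).trans (Fintype.card_fin 4)
  by_cases h : StrictMono (fun i => y i 0) ∧ ConvexFamily y
  · have hset : Prod.mk y ⁻¹' (Ψ ⁻¹' {x | SortedHole x e}) =
        Set.univ.pi fun _ => (interior (convexHull ℝ (Set.range y)))ᶜ := by
      ext z
      have : (SortedHole (Ψ (y, z)) e) ↔ ∀ j, z j ∉ interior (convexHull ℝ (Set.range y)) := by
        unfold SortedHole
        simp only [hΨ1, h, true_and, and_self]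
        exact ⟨fun H j => by simpa only [hΨ2] using H j j.2,
          fun H j hj => by rw [hΨ2 (y, z) ⟨j, hj⟩]; exact H ⟨j, hj⟩⟩
      simpa using this
    rw [hset, Measure.pi_pi, Finset.prod_const, Finset.card_univ, hcard, prob_compl_eq_one_sub hint,
      hμint, quadTerm, if_pos h]
  · have hset : Prod.mk y ⁻¹' (Ψ ⁻¹' {x | SortedHole x e}) = ∅ := by
      refine Set.eq_empty_of_forall_notMem fun z hz => h ?_
      have := (show SortedHole (Ψ (y, z)) e from hz).1
      simpa only [hΨ1] using this
    rw [hset, measure_empty, quadTerm, if_neg h]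

theorem EH_eq_descFactorial_mul {K : Set (Euc 2)} (hK : Convex ℝ K) (hKm : MeasurableSet K)
    (hvol : volume K = 1) (n : ℕ) :
    EH 2 4 K n = n.descFactorial 4 *
      (∫⁻ y, quadTerm (fun x : Euc 2 => x 0) volume (fun v => (1 - v) ^ (n - 4)) y
        ∂(Measure.pi fun _ => volume.restrict K)).toReal := by
  classical
  have hunif : unif K = volume.restrict K := by rw [unif, hvol, inv_one, one_smul]
  have hprob : IsProbabilityMeasure ((volume : Measure (Euc 2)).restrict K) :=
    ⟨by rw [Measure.restrict_apply_univ, hvol]⟩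
  rw [EH, hunif]
  have hae : (fun x : Fin n → Euc 2 => (holeCount 2 4 n x : ℝ)) =ᵐ[Measure.pi fun _ : Fin n =>
      (volume : Measure (Euc 2)).restrict K] fun x => ∑ e : Fin 4 ↪ Fin n,
        {x | SortedHole x e}.indicator (fun _ => (1 : ℝ)) x := by
    filter_upwards [ae_injective_apply_zero K n] with x hx
    rw [holeCount_eq_card_sortedHole hx, Finset.card_filter, Nat.cast_sum]
    refine Finset.sum_congr rfl fun e _ => ?_
    by_cases h : SortedHole x e
    · rw [Set.indicator_of_mem (show x ∈ {x | SortedHole x e} from h), if_pos h, Nat.cast_one]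
    · rw [Set.indicator_of_notMem (show x ∉ {x | SortedHole x e} from h), if_neg h, Nat.cast_zero]
  rw [integral_congr_ae hae, integral_finsetSum _ fun e _ =>
    (integrable_const (1 : ℝ)).indicator (measurableSet_sortedHole e)]
  simp_rw [integral_indicator_const _ (measurableSet_sortedHole _), Measure.real,
    measure_sortedHole hK hKm hvol]
  rw [Finset.sum_const, Finset.card_univ, Fintype.card_embedding_eq, Fintype.card_fin,
    Fintype.card_fin]
  simp

theorem tendsto_descFactorial_four_div_pow :
    Tendsto (fun n : ℕ => (n.descFactorial 4 : ℝ) / (n : ℝ) ^ 4) atTop (nhds 1) := by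
  have h : ∀ k : ℝ, Tendsto (fun n : ℕ => 1 - k / (n : ℝ)) atTop (nhds 1) := fun k => by
    simpa using (tendsto_const_div_atTop_nhds_zero_nat k).const_sub 1
  have h4 := ((h 1).mul (h 2)).mul (h 3)
  rw [one_mul, one_mul] at h4
  refine h4.congr' ?_
  filter_upwards [eventually_ge_atTop 4] with n hn
  have hn0 : (n : ℝ) ≠ 0 := by positivity
  simp only [Nat.descFactorial_succ, Nat.descFactorial_zero]
  push_cast [Nat.cast_sub (show 1 ≤ n by omega), Nat.cast_sub (show 2 ≤ n by omega),
    Nat.cast_sub (show 3 ≤ n by omega)]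
  field_simp
  simp
  ring

/-- For every convex body `K ⊆ ℝ²` of unit area,
`n^{-2} EH^K_{2,4}(n) → 10 - 2π²/3` as `n → ∞`. -/
theorem statement7 (K : Set (Euc 2)) (hK : IsConvexBody K) (hvol : volume K = 1) :
    Filter.Tendsto (fun n : ℕ => EH 2 4 K n / (n : ℝ) ^ 2) Filter.atTop
      (nhds (10 - 2 * Real.pi ^ 2 / 3)) := by
  obtain ⟨hconv, hcomp, -⟩ := hK
  have hlim := tendsto_sq_mul_lintegral_quadTerm_euclidean hconv hcomp.measurableSet hvol
  have hpos : 0 ≤ 10 - 2 * Real.pi ^ 2 / 3 := by nlinarith [Real.pi_pos, Real.pi_lt_d2]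
  have hreal := (ENNReal.tendsto_toReal ENNReal.ofReal_ne_top).comp hlim
  rw [ENNReal.toReal_ofReal hpos] at hreal
  have := tendsto_descFactorial_four_div_pow.mul hreal
  rw [one_mul] at this
  refine this.congr' ?_
  filter_upwards [eventually_gt_atTop 0] with n hn
  have hn0 : (n : ℝ) ≠ 0 := by positivity
  rw [EH_eq_descFactorial_mul hconv hcomp.measurableSet hvol]
  simp only [Function.comp_apply, ENNReal.toReal_mul, ENNReal.toReal_pow, ENNReal.toReal_natCast]
  field_simp
end

section
/- For every integer d ≥ 2 and every h ∈ (0, 1/4], the (d−1)-dimensional surface measure of the spherical cap boundary piece C(h) ∩ S^{d−1} is at most (4√h)^{d−1} times the (d−1)-dimensional surface measure of S^{d−1}; that is, λ_{d−1}(C(h) ∩ S^{d−1}) ≤ (4√h)^{d−1} · λ_{d−1}(S^{d−1}). -/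
open MeasureTheory

noncomputable section

/-- Shrinks the coordinates other than `j` by the factor `r` and chooses the `j`-th coordinate so
that the unit sphere is mapped into itself. -/
def capMap {d : ℕ} (j : Fin d) (r : ℝ) (x : Euc d) : Euc d :=
  WithLp.toLp 2 fun i => if i = j then √(1 - r ^ 2 * (1 - x j ^ 2)) else r * x i

lemma abs_coord_le_one {d : ℕ} {x : Euc d} (hx : x ∈ Metric.sphere (0 : Euc d) 1) (j : Fin d) :
    |x j| ≤ 1 := by
  have h1 := PiLp.norm_apply_le x j
  rw [mem_sphere_zero_iff_norm.1 hx] at h1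
  simpa using h1

lemma sphere_coord_sum {d : ℕ} {x : Euc d} (j : Fin d) :
    x ∈ Metric.sphere (0 : Euc d) 1 ↔
      x j ^ 2 + ∑ i ∈ Finset.univ.erase j, x i ^ 2 = 1 := by
  rw [Finset.add_sum_erase _ (fun i => x i ^ 2) (Finset.mem_univ j), mem_sphere_zero_iff_norm,
    ← EuclideanSpace.real_norm_sq_eq, pow_eq_one_iff_of_nonneg (norm_nonneg x) two_ne_zero]

lemma sq_sqrt_sub_sqrt_le {r s t : ℝ} (hr : r ^ 2 ≤ 1 / 2) (hs : |s| ≤ 1) (ht : |t| ≤ 1) :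
    (√(1 - r ^ 2 * (1 - s ^ 2)) - √(1 - r ^ 2 * (1 - t ^ 2))) ^ 2 ≤ r ^ 2 * (s - t) ^ 2 := by
  have hs2 : s ^ 2 ≤ 1 := (sq_le_one_iff_abs_le_one s).2 hs
  have ht2 : t ^ 2 ≤ 1 := (sq_le_one_iff_abs_le_one t).2 ht
  have hA : 1 / 2 ≤ 1 - r ^ 2 * (1 - s ^ 2) := by nlinarith [sq_nonneg r, sq_nonneg s]
  have hB : 1 / 2 ≤ 1 - r ^ 2 * (1 - t ^ 2) := by nlinarith [sq_nonneg r, sq_nonneg t]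
  have ha2 := Real.sq_sqrt (show 0 ≤ 1 - r ^ 2 * (1 - s ^ 2) by linarith)
  have hb2 := Real.sq_sqrt (show 0 ≤ 1 - r ^ 2 * (1 - t ^ 2) by linarith)
  have ha0 := Real.sqrt_nonneg (1 - r ^ 2 * (1 - s ^ 2))
  have hb0 := Real.sqrt_nonneg (1 - r ^ 2 * (1 - t ^ 2))
  set a := √(1 - r ^ 2 * (1 - s ^ 2))
  set b := √(1 - r ^ 2 * (1 - t ^ 2))
  have hab : 1 / 2 ≤ a * b := by
    have : (1 / 2 : ℝ) ^ 2 ≤ (a * b) ^ 2 := by rw [mul_pow, ha2, hb2]; nlinarith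
    exact le_of_sq_le_sq this (by positivity)
  have hsum : 2 ≤ (a + b) ^ 2 := by nlinarith
  have hst : (s + t) ^ 2 ≤ 4 := by nlinarith [sq_nonneg (s - t)]
  have hprod : (a - b) ^ 2 * (a + b) ^ 2 = r ^ 2 * (s - t) ^ 2 * (r ^ 2 * (s + t) ^ 2) := by
    have : (a - b) * (a + b) = r ^ 2 * ((s - t) * (s + t)) := by linear_combination ha2 - hb2
    rw [← mul_pow, this]; ring
  have h1 : r ^ 2 * (s + t) ^ 2 ≤ 2 := by nlinarith [sq_nonneg r, sq_nonneg (s + t)]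
  have h2 : (a - b) ^ 2 * 2 ≤ r ^ 2 * (s - t) ^ 2 * 2 := by
    calc (a - b) ^ 2 * 2 ≤ (a - b) ^ 2 * (a + b) ^ 2 := by gcongr
      _ = _ := hprod
      _ ≤ _ := by gcongr
  linarith

lemma lipschitzOnWith_capMap {d : ℕ} (j : Fin d) {r : NNReal} (hr : (r : ℝ) ^ 2 ≤ 1 / 2) :
    LipschitzOnWith r (capMap j r) (Metric.sphere (0 : Euc d) 1) := by
  refine LipschitzOnWith.of_dist_le_mul fun x hx y hy => ?_
  refine le_of_sq_le_sq ?_ (by positivity)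
  rw [mul_pow, EuclideanSpace.dist_sq_eq, EuclideanSpace.dist_sq_eq, Finset.mul_sum]
  refine Finset.sum_le_sum fun i _ => ?_
  simp only [capMap, Real.dist_eq, sq_abs]
  split_ifs with hi
  · subst hi
    exact sq_sqrt_sub_sqrt_le hr (abs_coord_le_one hx i) (abs_coord_le_one hy i)
  · exact (by ring : _ = _).le

lemma cap_subset_image_capMap {d : ℕ} (j : Fin d) {r u : ℝ} (hr : 0 < r) (hu : 0 ≤ u)
    (hru : r ^ 2 + u ^ 2 = 1) {y : Euc d} (hy : y ∈ Metric.sphere (0 : Euc d) 1)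
    (hyu : u ≤ y j) : y ∈ capMap j r '' Metric.sphere (0 : Euc d) 1 := by
  have hy1 := (sphere_coord_sum j).1 hy
  have hnn : 0 ≤ 1 - (1 - y j ^ 2) / r ^ 2 := by
    rw [sub_nonneg, div_le_one (by positivity)]
    nlinarith
  refine ⟨WithLp.toLp 2 fun i => if i = j then √(1 - (1 - y j ^ 2) / r ^ 2) else y i / r, ?_, ?_⟩
  · rw [sphere_coord_sum j]
    have : ∑ i ∈ Finset.univ.erase j,
        (if i = j then √(1 - (1 - y j ^ 2) / r ^ 2) else y i / r) ^ 2
        = (∑ i ∈ Finset.univ.erase j, y i ^ 2) / r ^ 2 := by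
      rw [Finset.sum_div]
      refine Finset.sum_congr rfl fun i hi => ?_
      rw [if_neg (Finset.ne_of_mem_erase hi), div_pow]
    simp only [this, if_true, Real.sq_sqrt hnn]
    rw [← hy1]
    ring
  · ext i
    simp only [capMap, if_true, Real.sq_sqrt hnn]
    split_ifs with hi
    · subst hi
      have : 1 - r ^ 2 * (1 - (1 - (1 - y i ^ 2) / r ^ 2)) = y i ^ 2 := by field_simp; ring
      rw [this, Real.sqrt_sq (hu.trans hyu)]
    · field_simp

/-- For every `d ≥ 2` and `h ∈ (0, 1/4]`, the `(d-1)`-dimensional surface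
measure of `C(h) ∩ S^{d-1}` is at most `(4√h)^{d-1}` times the `(d-1)`-dimensional
surface measure of `S^{d-1}`, where `C(h)` is the spherical cap of height `h`. -/
theorem statement9 (d : ℕ) (hd : 2 ≤ d) (h : ℝ) (hh0 : 0 < h) (hh : h ≤ 1 / 4) :
    μH[((d : ℝ) - 1)]
        ({x : Euc d | x ∈ Metric.closedBall 0 1 ∧ 1 - h ≤ x ⟨0, by omega⟩}
          ∩ Metric.sphere (0 : Euc d) 1) ≤
      ENNReal.ofReal ((4 * Real.sqrt h) ^ (d - 1)) *
        μH[((d : ℝ) - 1)] (Metric.sphere (0 : Euc d) 1) := by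
  have hpos : 0 < 2 * h - h ^ 2 := by nlinarith
  set r : NNReal := ⟨√(2 * h - h ^ 2), Real.sqrt_nonneg _⟩
  have hr2 : (r : ℝ) ^ 2 = 2 * h - h ^ 2 := Real.sq_sqrt hpos.le
  have hr0 : 0 < (r : ℝ) := Real.sqrt_pos.2 hpos
  have hrle : (r : ℝ) ≤ 4 * √h := by
    refine le_of_sq_le_sq ?_ (by positivity)
    rw [hr2, mul_pow, Real.sq_sqrt hh0.le]
    nlinarith
  have hdim : (d : ℝ) - 1 = ((d - 1 : ℕ) : ℝ) := by
    rw [Nat.cast_sub (by omega), Nat.cast_one]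
  calc μH[((d : ℝ) - 1)] _
      ≤ μH[((d : ℝ) - 1)] (capMap ⟨0, by omega⟩ r '' Metric.sphere (0 : Euc d) 1) := by
        refine measure_mono fun y hy => ?_
        exact cap_subset_image_capMap _ hr0 (by linarith : 0 ≤ 1 - h) (by rw [hr2]; ring)
          hy.2 hy.1.2
    _ ≤ (r : ENNReal) ^ ((d : ℝ) - 1) * μH[((d : ℝ) - 1)] (Metric.sphere (0 : Euc d) 1) :=
        (lipschitzOnWith_capMap _ (by rw [hr2]; nlinarith)).hausdorffMeasure_image_le
          (by rw [hdim]; positivity)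
    _ ≤ _ := by
        gcongr
        rw [hdim, ENNReal.rpow_natCast, ENNReal.ofReal_pow (by positivity)]
        gcongr
        rw [← ENNReal.ofReal_coe_nnreal]
        exact ENNReal.ofReal_le_ofReal hrle
end
end

section
/- For every integer d ≥ 1 there exists a constant c = c(d) such that the following holds: for every real D > 0 and every ε ∈ (0, D/(4√(2d(d+1)))), if R is a d-dimensional ε-regular simplex in ℝ^d with diameter D, then there is a circumscribed ellipsoid of R whose diameter is at most c·D. -/
open MeasureTheory

noncomputable section

/-- A simplex with vertices `r` is `ε`-regular if there is a regular simplex with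
vertices `r'` (affinely independent points with all pairwise distances equal) such
that `dist (r i) (r' i) ≤ ε` for every `i`. -/
def IsEpsRegular {d : ℕ} (ε : ℝ) (r : Fin (d + 1) → Euc d) : Prop :=
  ∃ r' : Fin (d + 1) → Euc d, AffineIndependent ℝ r' ∧
    (∃ s : ℝ, ∀ i j, i ≠ j → dist (r' i) (r' j) = s) ∧
    ∀ i, dist (r i) (r' i) ≤ ε

/-- In positive dimension, the unit sphere of `ℝ^d` contains the vertices of a nondegenerate
simplex. -/
theorem exists_affineBasis_norm_eq_one (d : ℕ) (hd : 1 ≤ d) :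
    ∃ b : AffineBasis (Fin (d + 1)) ℝ (Euc d), ∀ i, ‖b i‖ = 1 := by
  obtain ⟨n, rfl⟩ := Nat.exists_eq_add_of_le' hd
  let p : Fin (n + 1 + 1) → Euc (n + 1) :=
    Fin.cons (-EuclideanSpace.single 0 1) fun i => EuclideanSpace.single i 1
  have hp : AffineIndependent ℝ p := by
    rw [affineIndependent_iff_of_fintype]
    intro w hw hs
    rw [Finset.univ.weightedVSub_eq_linear_combination hw] at hs
    rw [Fin.sum_univ_succ] at hw hs
    have hcoord (j : Fin (n + 1)) : w j.succ = if j = 0 then w 0 else 0 := by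
      have h := congrArg (fun v : Euc (n + 1) => v j) hs
      simp only [p, Fin.cons_zero, Fin.cons_succ, PiLp.add_apply, PiLp.smul_apply, PiLp.neg_apply,
        WithLp.ofLp_sum, Finset.sum_apply, PiLp.single_apply, PiLp.zero_apply, smul_eq_mul,
        mul_ite, mul_one, mul_zero, Finset.sum_ite_eq, Finset.mem_univ, if_true] at h
      split_ifs at h ⊢ <;> linarith
    have h0 : w 0 = 0 := by
      simp only [hcoord, Finset.sum_ite_eq', Finset.mem_univ, if_true] at hw
      linarith
    intro i
    refine Fin.cases h0 (fun j => ?_) i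
    simp [hcoord, h0]
  refine ⟨⟨p, hp, hp.affineSpan_eq_top_iff_card_eq_finrank_add_one.2 (by simp)⟩, fun i => ?_⟩
  change ‖p i‖ = 1
  refine Fin.cases ?_ (fun j => ?_) i <;> simp [p]

/-- Two affine bases with the same index type are related by an affine equivalence. -/
theorem AffineBasis.exists_affineEquiv {ι k V P : Type*} [Ring k] [AddCommGroup V] [Module k V]
    [AddTorsor V P] (b b' : AffineBasis ι k P) : ∃ f : P ≃ᵃ[k] P, ∀ i, f (b i) = b' i := by
  obtain ⟨o⟩ := b.nonempty
  let L : V ≃ₗ[k] V := (b.basisOf o).equiv (b'.basisOf o) (Equiv.refl _)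
  refine ⟨(AffineEquiv.vaddConst k (b o)).symm.trans
    (L.toAffineEquiv.trans (AffineEquiv.vaddConst k (b' o))), fun i => ?_⟩
  by_cases hi : i = o
  · subst hi
    simp
  · have h : L (b i -ᵥ b o) = b' i -ᵥ b' o := by
      simpa using (b.basisOf o).equiv_apply ⟨i, hi⟩ (b'.basisOf o) (Equiv.refl _)
    simp [h]

/-- The linear part of an affine map is controlled by the largest distance between the images of
the points of a fixed affine basis. -/
theorem AffineBasis.exists_norm_linear_le {ι V W : Type*} [Fintype ι]
    [NormedAddCommGroup V] [NormedSpace ℝ V] [FiniteDimensional ℝ V]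
    [NormedAddCommGroup W] [NormedSpace ℝ W] (b : AffineBasis ι ℝ V) :
    ∃ K : ℝ, 0 ≤ K ∧ ∀ (f : V →ᵃ[ℝ] W) (D : ℝ), (∀ i j, dist (f (b i)) (f (b j)) ≤ D) →
      ∀ v, ‖f.linear v‖ ≤ K * D * ‖v‖ := by
  classical
  obtain ⟨o⟩ := b.nonempty
  let B := b.basisOf o
  refine ⟨∑ j, ‖(B.coord j).toContinuousLinearMap‖, by positivity, fun f D hD v => ?_⟩
  calc ‖f.linear v‖ = ‖∑ j, B.repr v j • f.linear (B j)‖ := by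
        conv_lhs => rw [← B.sum_repr v, map_sum]
        simp only [map_smul]
    _ ≤ ∑ j, ‖(B.coord j).toContinuousLinearMap‖ * ‖v‖ * D := by
        refine norm_sum_le_of_le _ fun j _ => ?_
        rw [norm_smul]
        gcongr
        · exact (B.coord j).toContinuousLinearMap.le_opNorm v
        · rw [b.basisOf_apply, f.linearMap_vsub, vsub_eq_sub, ← dist_eq_norm]
          exact hD _ _
    _ = _ := by
        rw [Finset.sum_mul, Finset.sum_mul]
        exact Finset.sum_congr rfl fun j _ => by ring

/-- For every `d ≥ 1` there is `c = c(d)` such that: for every `D > 0` and every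
`ε ∈ (0, D/(4√(2d(d+1))))`, if `R` is a `d`-dimensional `ε`-regular simplex in `ℝ^d`
of diameter `D`, then `R` has a circumscribed ellipsoid of diameter at most `c·D`. -/
theorem statement12 (d : ℕ) (hd : 1 ≤ d) :
    ∃ c : ℝ, ∀ D : ℝ, 0 < D →
      ∀ ε : ℝ, 0 < ε → ε < D / (4 * Real.sqrt (2 * d * (d + 1))) →
      ∀ r : Fin (d + 1) → Euc d, AffineIndependent ℝ r →
        IsEpsRegular ε r →
        Metric.diam (convexHull ℝ (Set.range r)) = D →
        ∃ f : Euc d ≃ᵃ[ℝ] Euc d,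
          convexHull ℝ (Set.range r) ⊆ ⇑f '' Metric.closedBall (0 : Euc d) 1 ∧
          (∀ i, r i ∈ ⇑f '' Metric.sphere (0 : Euc d) 1) ∧
          Metric.diam (⇑f '' Metric.closedBall (0 : Euc d) 1) ≤ c * D := by
  obtain ⟨b, hb⟩ := exists_affineBasis_norm_eq_one d hd
  obtain ⟨K, hK, hlin⟩ := b.exists_norm_linear_le (W := Euc d)
  refine ⟨K * 2, fun D hD ε _ _ r hr _ hdiam => ?_⟩
  let b' : AffineBasis (Fin (d + 1)) ℝ (Euc d) :=
    ⟨r, hr, hr.affineSpan_eq_top_iff_card_eq_finrank_add_one.2 (by simp)⟩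
  obtain ⟨f, hf⟩ := b.exists_affineEquiv b'
  replace hf : ∀ i, f (b i) = r i := hf
  have hsphere (i) : r i ∈ ⇑f '' Metric.sphere (0 : Euc d) 1 :=
    ⟨b i, by simp [hb], hf i⟩
  have hdist (i j) : dist (f (b i)) (f (b j)) ≤ D := by
    rw [hf, hf, ← hdiam, convexHull_diam]
    exact Metric.dist_le_diam_of_mem (Set.finite_range r).isBounded ⟨i, rfl⟩ ⟨j, rfl⟩
  refine ⟨f, convexHull_min ?_ ?_, hsphere, ?_⟩
  · rintro _ ⟨i, rfl⟩
    exact Set.image_mono Metric.sphere_subset_closedBall (hsphere i)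
  · exact (convex_closedBall (0 : Euc d) 1).affine_image f.toAffineMap
  · refine Metric.diam_le_of_forall_dist_le (by positivity) ?_
    rintro _ ⟨x, hx, rfl⟩ _ ⟨y, hy, rfl⟩
    have hxy : ‖x - y‖ ≤ 2 := by
      rw [mem_closedBall_zero_iff] at hx hy
      linarith [norm_sub_le x y]
    calc dist (f x) (f y) = ‖f.toAffineMap.linear (x - y)‖ := by
          rw [dist_eq_norm, ← vsub_eq_sub x y, AffineMap.linearMap_vsub]
          rfl
      _ ≤ K * D * ‖x - y‖ := hlin f.toAffineMap D hdist _
      _ ≤ K * D * 2 := by gcongr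
      _ = K * 2 * D := by ring
end
end

section
/- The double integral ∫₀^∞ (e^{−z}/z) · (∫₀^z (1 − e^{−t})/t dt) dz equals π²/12. -/
open MeasureTheory

lemma norm_one_sub_exp_neg_div_le_one {x : ℝ} (hx : 0 ≤ x) :
    ‖(1 - Real.exp (-x)) / x‖ ≤ 1 := by
  have hexp : Real.exp (-x) ≤ 1 := Real.exp_le_one_iff.2 (by linarith)
  rw [Real.norm_of_nonneg (div_nonneg (by linarith) hx)]
  exact div_le_one_of_le₀ (by linarith [Real.add_one_le_exp (-x)]) hx

lemma hasSum_alternating_inv_sq :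
    HasSum (fun n : ℕ => (-1 : ℝ) ^ n / ((n : ℝ) + 1) ^ 2) (Real.pi ^ 2 / 12) := by
  have h := hasSum_one_div_nat_pow_mul_cos one_ne_zero
    (show (1 / 2 : ℝ) ∈ Set.Icc (0 : ℝ) 1 by constructor <;> norm_num)
  have hB : (Polynomial.map (algebraMap ℚ ℝ) (Polynomial.bernoulli (2 * 1))).eval (1 / 2 : ℝ)
      = -1 / 12 := by
    norm_num [Polynomial.bernoulli, Finset.sum_range_succ, bernoulli_one, bernoulli_two,
      Polynomial.eval_map, Polynomial.eval₂_add]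
  rw [hB, ← hasSum_nat_add_iff' 1] at h
  convert! h.neg using 1
  · funext n
    have hcos : Real.cos (2 * Real.pi * ((n + 1 : ℕ) : ℝ) * (1 / 2)) = (-1) ^ (n + 1) := by
      rw [← Real.cos_nat_mul_pi]
      ring_nf
    rw [hcos, pow_succ]
    push_cast
    ring
  · simp [Nat.factorial]
    ring

lemma integral_Ioc_pow (n : ℕ) : ∫ s in Set.Ioc (0 : ℝ) 1, s ^ n = 1 / ((n : ℝ) + 1) := by
  rw [← intervalIntegral.integral_of_le zero_le_one, integral_pow]
  simp

lemma integral_log_one_add_div :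
    ∫ s in Set.Ioc (0 : ℝ) 1, Real.log (1 + s) / s = Real.pi ^ 2 / 12 := by
  let F : ℕ → ℝ → ℝ := fun n s => (-1) ^ n / ((n : ℝ) + 1) * s ^ n
  have hF_int (n : ℕ) : Integrable (F n) (volume.restrict (Set.Ioc (0 : ℝ) 1)) :=
    (by fun_prop : Continuous (F n)).integrableOn_Ioc
  have hF_norm (n : ℕ) : ∫ s in Set.Ioc (0 : ℝ) 1, ‖F n s‖ = 1 / ((n : ℝ) + 1) ^ 2 := by
    have h : ∀ s ∈ Set.Ioc (0 : ℝ) 1, ‖F n s‖ = 1 / ((n : ℝ) + 1) * s ^ n := by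
      intro s hs
      have hn : |(n : ℝ) + 1| = n + 1 := abs_of_pos (by positivity)
      simp [F, abs_of_pos hs.1, hn]
    rw [setIntegral_congr_fun measurableSet_Ioc h, integral_const_mul, integral_Ioc_pow]
    field_simp
  have hF_sum : Summable fun n => ∫ s in Set.Ioc (0 : ℝ) 1, ‖F n s‖ := by
    simp_rw [hF_norm]
    exact_mod_cast (summable_nat_add_iff 1).2 hasSum_zeta_two.summable
  have h := hasSum_integral_of_summable_integral_norm hF_int hF_sum
  have hF_val (n : ℕ) : ∫ s in Set.Ioc (0 : ℝ) 1, F n s = (-1) ^ n / ((n : ℝ) + 1) ^ 2 := by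
    rw [integral_const_mul, integral_Ioc_pow]
    field_simp
  simp_rw [hF_val] at h
  rw [← h.unique hasSum_alternating_inv_sq, integral_Ioc_eq_integral_Ioo,
    integral_Ioc_eq_integral_Ioo]
  refine setIntegral_congr_fun measurableSet_Ioo fun s hs => ?_
  have hlog := Real.hasSum_pow_div_log_of_abs_lt_one
    (show |-s| < 1 by rw [abs_neg, abs_of_pos hs.1]; exact hs.2)
  have hs0 : s ≠ 0 := hs.1.ne'
  have hterm (n : ℕ) : F n s = -s⁻¹ * ((-s) ^ (n + 1) / ((n : ℝ) + 1)) := by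
    rw [pow_succ, neg_pow]
    simp only [F]
    field_simp
  simp only [hterm, (hlog.mul_left (-s⁻¹)).tsum_eq, sub_neg_eq_add]
  ring

lemma integral_exp_neg_mul_one_sub_exp_neg_div {s : ℝ} (hs : 0 < s) :
    ∫ z in Set.Ioi (0 : ℝ), Real.exp (-z) * ((1 - Real.exp (-(z * s))) / (z * s))
      = Real.log (1 + s) / s := by
  have heq (z : ℝ) (hz : z ∈ Set.Ioi (0 : ℝ)) :
      Real.exp (-z) * ((1 - Real.exp (-(z * s))) / (z * s))
        = s⁻¹ * (z⁻¹ • (Real.exp (-(1 * z)) - Real.exp (-((1 + s) * z)))) := by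
    have hz0 : z ≠ 0 := ne_of_gt hz
    rw [show -((1 + s) * z) = -z + -(z * s) by ring, Real.exp_add, one_mul, smul_eq_mul]
    field_simp
  have hint : IntegrableOn
      (fun z : ℝ => z⁻¹ • (Real.exp (-(1 * z)) - Real.exp (-((1 + s) * z)))) (Set.Ioi 0) := by
    have hmain : IntegrableOn
        (fun z : ℝ => Real.exp (-z) * ((1 - Real.exp (-(z * s))) / (z * s))) (Set.Ioi 0) := by
      refine (integrableOn_exp_neg_Ioi 0).mono' (by fun_prop) ?_
      filter_upwards [ae_restrict_mem measurableSet_Ioi] with z hz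
      rw [norm_mul, Real.norm_of_nonneg (Real.exp_pos _).le]
      exact mul_le_of_le_one_right (Real.exp_pos _).le
        (norm_one_sub_exp_neg_div_le_one (mul_pos hz hs).le)
    refine IntegrableOn.congr_fun (hmain.const_mul s) (fun z hz => ?_) measurableSet_Ioi
    simp only [heq z hz]
    field_simp
  rw [setIntegral_congr_fun measurableSet_Ioi heq, integral_const_mul,
    Frullani.integral_Ioi_eq (f := fun x => Real.exp (-x)) (L := 1) (R := 0) ?_ one_pos
      (by linarith) ?_ ?_ hint]
  · simp
    field_simp
  · exact (by fun_prop : Continuous fun x : ℝ => Real.exp (-x))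
      |>.locallyIntegrable.locallyIntegrableOn _
  · have h : ContinuousAt (fun x : ℝ => Real.exp (-x)) 0 := by fun_prop
    simpa [ContinuousAt] using h.tendsto.mono_left nhdsWithin_le_nhds
  · exact Real.tendsto_exp_neg_atTop_nhds_zero

lemma integrable_exp_neg_mul_one_sub_exp_neg_div :
    Integrable (Function.uncurry fun z s : ℝ =>
        Real.exp (-z) * ((1 - Real.exp (-(z * s))) / (z * s)))
      ((volume.restrict (Set.Ioi 0)).prod (volume.restrict (Set.Ioc 0 1))) := by
  have hbound : Integrable (fun p : ℝ × ℝ => Real.exp (-p.1) * 1)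
      ((volume.restrict (Set.Ioi 0)).prod (volume.restrict (Set.Ioc 0 1))) :=
    (integrableOn_exp_neg_Ioi 0).mul_prod (integrable_const (1 : ℝ))
  refine hbound.mono' ?_ ?_
  · exact (by unfold Function.uncurry; fun_prop : Measurable _).aestronglyMeasurable
  · rw [Measure.prod_restrict]
    filter_upwards [ae_restrict_mem (measurableSet_Ioi.prod measurableSet_Ioc)] with p hp
    rw [Function.uncurry, norm_mul, Real.norm_of_nonneg (Real.exp_pos _).le]
    exact mul_le_mul_of_nonneg_left
      (norm_one_sub_exp_neg_div_le_one (mul_pos hp.1 hp.2.1).le) (Real.exp_pos _).le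

/-- `∫₀^∞ (e^{-z}/z) · (∫₀^z (1 - e^{-t})/t dt) dz = π²/12`. -/
theorem statement13 :
    ∫ z in Set.Ioi (0 : ℝ),
        (Real.exp (-z) / z) * ∫ t in Set.Ioc (0 : ℝ) z, (1 - Real.exp (-t)) / t
      = Real.pi ^ 2 / 12 := by
  have hscale (z : ℝ) (hz : z ∈ Set.Ioi (0 : ℝ)) :
      (Real.exp (-z) / z) * ∫ t in Set.Ioc (0 : ℝ) z, (1 - Real.exp (-t)) / t
        = ∫ s in Set.Ioc (0 : ℝ) 1, Real.exp (-z) * ((1 - Real.exp (-(z * s))) / (z * s)) := by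
    rw [integral_const_mul, ← intervalIntegral.integral_of_le zero_le_one,
      ← intervalIntegral.integral_of_le (le_of_lt hz),
      intervalIntegral.integral_comp_mul_left (fun t => (1 - Real.exp (-t)) / t) (ne_of_gt hz),
      mul_zero, mul_one, smul_eq_mul, div_eq_mul_inv, mul_assoc]
  rw [setIntegral_congr_fun measurableSet_Ioi hscale,
    integral_integral_swap integrable_exp_neg_mul_one_sub_exp_neg_div,
    setIntegral_congr_fun measurableSet_Ioc fun s hs =>
      integral_exp_neg_mul_one_sub_exp_neg_div hs.1]
  exact integral_log_one_add_div
end
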